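/- For any two conjugate elements u, v of the surface group G, the sum |u| + |v| is even and there exists x ∈ G with x⁻¹ux = v and |x| ≤ (|u| + |v|)/2 + 8g − 1. -/

import Mathlib

namespace SG

/-- A letter of the alphabet `S± = {cᵢ^{±1}}`: `(i, true)` is `c_{i+1}`,
`(i, false)` is `c_{i+1}⁻¹`. -/
abbrev Letter (g : ℕ) := Fin (2*g) × Bool

/-- A word in the alphabet `S±`. -/
abbrev Word (g : ℕ) := List (Letter g)

/-- The surface relator `c₁c₂⋯c_{2g}c₁⁻¹c₂⁻¹⋯c_{2g}⁻¹` in the free group. -/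
def relator (g : ℕ) : FreeGroup (Fin (2*g)) :=
  (List.ofFn fun i : Fin (2*g) => FreeGroup.of i).prod *
  (List.ofFn fun i : Fin (2*g) => (FreeGroup.of i)⁻¹).prod

/-- The surface group with the symmetric presentation. -/
abbrev SurfaceGroup (g : ℕ) :=
  PresentedGroup ({relator g} : Set (FreeGroup (Fin (2*g))))

/-- The generator `c_{i+1}` of the surface group. -/
def gen (g : ℕ) (i : Fin (2*g)) : SurfaceGroup g := PresentedGroup.of i

/-- The inverse of a letter. -/
def invLetter (g : ℕ) (a : Letter g) : Letter g := (a.1, !a.2)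

/-- The group element represented by a letter. -/
def evalLetter (g : ℕ) (a : Letter g) : SurfaceGroup g :=
  if a.2 then gen g a.1 else (gen g a.1)⁻¹

/-- The group element represented by a word. -/
def eval (g : ℕ) (W : Word g) : SurfaceGroup g := (W.map (evalLetter g)).prod

/-- The formal inverse `x_n⁻¹ ⋯ x₁⁻¹` of a word `x₁ ⋯ x_n`. -/
def wordInv (g : ℕ) (W : Word g) : Word g := (W.map (invLetter g)).reverse

/-- Word length of a group element: the least `n` such that the element is a
product of `n` elements of `S ∪ S⁻¹`. -/
noncomputable def len (g : ℕ) (u : SurfaceGroup g) : ℕ :=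
  sInf {n | ∃ W : Word g, W.length = n ∧ eval g W = u}

/-- `conjLen g u v` is the minimum of `|x|` over conjugators `x` with `x⁻¹ux = v`. -/
noncomputable def conjLen (g : ℕ) (u v : SurfaceGroup g) : ℕ :=
  sInf {k | ∃ x : SurfaceGroup g, x⁻¹ * u * x = v ∧ len g x = k}

/-- The conjugator length function: `CL g n` is the least `N` such that any
conjugate `u, v` with `|u| + |v| ≤ n` admit a conjugator of length `≤ N`. -/
noncomputable def CL (g : ℕ) (n : ℕ) : ℕ :=
  sInf {N | ∀ u v : SurfaceGroup g,
    (∃ x : SurfaceGroup g, x⁻¹ * u * x = v) → len g u + len g v ≤ n →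
      conjLen g u v ≤ N}

/-- Rank of a letter in the ascending order
`c_{2g} ≺ ⋯ ≺ c₂ ≺ c₁ ≺ c₁⁻¹ ≺ c₂⁻¹ ≺ ⋯ ≺ c_{2g}⁻¹`. -/
def rank (g : ℕ) (a : Letter g) : ℕ :=
  if a.2 then (2*g - 1) - (a.1 : ℕ) else 2*g + (a.1 : ℕ)

/-- The strict order `≺` on letters. -/
def letterLt (g : ℕ) (a b : Letter g) : Prop := rank g a < rank g b

/-- The length-lexicographical order `≺` on words. -/
def wordLt (g : ℕ) (X Y : Word g) : Prop :=
  X.length < Y.length ∨ (X.length = Y.length ∧ List.Lex (letterLt g) X Y)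

/-- A word is irreducible if it is the `≺`-least word representing its element. -/
def IrreducibleWord (g : ℕ) (W : Word g) : Prop :=
  ∀ W' : Word g, eval g W' = eval g W → W' = W ∨ wordLt g W W'

/-- A word is cyclically irreducible if all its cyclic permutations are irreducible. -/
def CyclicallyIrreducibleWord (g : ℕ) (W : Word g) : Prop :=
  ∀ W' : Word g, List.IsRotated W W' → IrreducibleWord g W'

/-- A word is freely reduced if no letter is followed by its inverse. -/
def FreelyReduced (g : ℕ) (W : Word g) : Prop :=
  List.Chain' (fun a c => c ≠ invLetter g a) W

/-- The normal form of a group element: the `≺`-least word representing it. -/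
noncomputable def nf (g : ℕ) (x : SurfaceGroup g) : Word g := by
  classical
  exact if h : ∃ W : Word g, eval g W = x ∧ IrreducibleWord g W then h.choose else []

/-- The word `R = c₁c₂⋯c_{2g}c₁⁻¹c₂⁻¹⋯c_{2g}⁻¹`. -/
def Rword (g : ℕ) : Word g :=
  (List.ofFn fun i : Fin (2*g) => ((i, true) : Letter g)) ++
  (List.ofFn fun i : Fin (2*g) => ((i, false) : Letter g))

/-- `𝓡`: all cyclic permutations of `R` and of `R⁻¹`. -/
def RSet (g : ℕ) : Set (Word g) :=
  {W | List.IsRotated (Rword g) W ∨ List.IsRotated (wordInv g (Rword g)) W}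

/-- `seg g b i k` is the word `b_i b_{i+1} ⋯ b_{i+k-1}`. -/
def seg (g : ℕ) (b : ℕ → Letter g) (i k : ℕ) : Word g :=
  (List.range k).map fun j => b (i + j)

/-- `dseg g b i k` is the descending word `b_i b_{i-1} ⋯ b_{i-k+1}`
(indices taken modulo `4g`, using periodicity of `b`). -/
def dseg (g : ℕ) (b : ℕ → Letter g) (i k : ℕ) : Word g :=
  (List.range k).map fun j => b (i + 4*g - j)

/-- `b : ℕ → Letter g` is a `4g`-periodic (1-based) enumeration of the letters
`b₁, …, b_{4g}` of some word `b₁⋯b_{4g} ∈ 𝓡`. -/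
def RelSeq (g : ℕ) (b : ℕ → Letter g) : Prop :=
  (∀ i, b (i + 4*g) = b i) ∧ seg g b 1 (4*g) ∈ RSet g

/-- The `t`-th power `W^t` of a word. -/
def wpow (g : ℕ) (W : Word g) (t : ℕ) : Word g := (List.replicate t W).flatten

/-- A `k`-fractional relator: an initial segment of length `k` (with `2 ≤ k ≤ 4g`)
of some word in `𝓡`. -/
def IsFR (g : ℕ) (k : ℕ) (W : Word g) : Prop :=
  2 ≤ k ∧ k ≤ 4*g ∧ ∃ B ∈ RSet g, W = B.take k

/-- `IsLLFROcc g k W P F Q` : the factorization `W = P ++ F ++ Q` exhibits `F`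
as a `k`-locally longest fractional relator of `W`. -/
def IsLLFROcc (g : ℕ) (k : ℕ) (W P F Q : Word g) : Prop :=
  W = P ++ F ++ Q ∧ IsFR g k F ∧
  (∀ a, P.getLast? = some a → ¬ IsFR g (k+1) (a :: F)) ∧
  (∀ a, Q.head? = some a → ¬ IsFR g (k+1) (F ++ [a]))

/-- `W` contains a `k`-LLFR. -/
def HasLLFR (g : ℕ) (k : ℕ) (W : Word g) : Prop :=
  ∃ P F Q, IsLLFROcc g k W P F Q

/-- Length-lexicographical order on pairs of words. -/
def pairLt (g : ℕ) (p q : Word g × Word g) : Prop :=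
  wordLt g p.1 q.1 ∨ (p.1 = q.1 ∧ wordLt g p.2 q.2)

/-- A candidate for the reducing-subword pair of `(W₁, W₂)`. -/
def IsRSCand (g : ℕ) (W₁ W₂ C₁ C₂ : Word g) : Prop :=
  ∃ A B C' : Word g, W₁ = A ++ C₁ ∧ W₂ = C₂ ++ B ∧
    nf g (eval g (W₁ ++ W₂)) = A ++ C' ++ B

/-- `(C₁, C₂)` is the reducing-subword pair `rs(W₁, W₂)`: the `≺`-least candidate. -/
def IsRS (g : ℕ) (W₁ W₂ C₁ C₂ : Word g) : Prop :=
  IsRSCand g W₁ W₂ C₁ C₂ ∧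
  ∀ D₁ D₂ : Word g, IsRSCand g W₁ W₂ D₁ D₂ →
    (C₁ = D₁ ∧ C₂ = D₂) ∨ pairLt g (C₁, C₂) (D₁, D₂)

end SG

namespace SGP
open SG Pointwise

section basics
variable {g : ℕ}

lemma eval_nil : eval g [] = 1 := rfl

lemma eval_append (W V : Word g) : eval g (W ++ V) = eval g W * eval g V := by
  simp [eval]

lemma eval_singleton (a : Letter g) : eval g [a] = evalLetter g a := by
  simp [eval]

lemma exists_word (x : SurfaceGroup g) : ∃ W : Word g, eval g W = x := by
  let H : Subgroup (SurfaceGroup g) :=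
    { carrier := {x | ∃ W : Word g, eval g W = x}
      mul_mem' := by
        rintro a b ⟨W, rfl⟩ ⟨V, rfl⟩
        exact ⟨W ++ V, eval_append W V⟩
      one_mem' := ⟨[], rfl⟩
      inv_mem' := by
        rintro a ⟨W, rfl⟩
        induction W with
        | nil => exact ⟨[], by simp [eval]⟩
        | cons b W ih =>
          obtain ⟨V, hV⟩ := ih
          refine ⟨V ++ [(b.1, !b.2)], ?_⟩
          rw [eval_append, hV, eval_singleton]
          have : eval g (b :: W) = evalLetter g b * eval g W := by simp [eval]
          rw [this, mul_inv_rev]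
          congr 1
          rcases b with ⟨i, b⟩
          cases b <;> simp [evalLetter] }
  exact PresentedGroup.generated_by _ H
    (fun j => ⟨[(j, true)], by simp [eval_singleton, evalLetter, gen]⟩) x

lemma len_spec (x : SurfaceGroup g) : ∃ W : Word g, W.length = len g x ∧ eval g W = x := by
  have h : {n | ∃ W : Word g, W.length = n ∧ eval g W = x}.Nonempty := by
    obtain ⟨W, hW⟩ := exists_word x
    exact ⟨W.length, W, rfl, hW⟩
  exact Nat.sInf_mem h

lemma len_le (W : Word g) : len g (eval g W) ≤ W.length :=
  Nat.sInf_le ⟨W, rfl, rfl⟩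

lemma len_one : len g 1 = 0 := by
  have := len_le (g := g) []
  simpa [eval_nil] using this

lemma len_mul (x y : SurfaceGroup g) : len g (x * y) ≤ len g x + len g y := by
  obtain ⟨W, hW, rfl⟩ := len_spec x
  obtain ⟨V, hV, rfl⟩ := len_spec y
  rw [← hW, ← hV, ← eval_append]
  simpa using len_le (W ++ V)

lemma len_letter (a : Letter g) : len g (evalLetter g a) ≤ 1 := by
  rw [← eval_singleton]; exact len_le [a]

lemma len_inv_le (x : SurfaceGroup g) : len g x⁻¹ ≤ len g x := by
  obtain ⟨W, hW, rfl⟩ := len_spec x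
  rw [← hW]
  clear hW
  induction W with
  | nil => simp [eval_nil, len_one]
  | cons b W ih =>
    have : eval g (b :: W) = evalLetter g b * eval g W := by simp [eval]
    rw [this, mul_inv_rev]
    have h1 : (evalLetter g b)⁻¹ = evalLetter g (b.1, !b.2) := by
      rcases b with ⟨i, b⟩
      cases b <;> simp [evalLetter]
    have h2 := len_mul (eval g W)⁻¹ (evalLetter g b)⁻¹
    have h3 := len_letter (b.1, !b.2)
    rw [← h1] at h3
    simp only [List.length_cons]
    omega

lemma len_inv (x : SurfaceGroup g) : len g x⁻¹ = len g x := by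
  apply le_antisymm (len_inv_le x)
  simpa using len_inv_le x⁻¹

lemma len_pow_le (x : SurfaceGroup g) (n : ℕ) : len g (x ^ n) ≤ n * len g x := by
  induction n with
  | zero => simp [len_one]
  | succ n ih =>
    rw [pow_succ]
    have := len_mul (x ^ n) x
    nlinarith

lemma len_zpow_le (x : SurfaceGroup g) (n : ℤ) : len g (x ^ n) ≤ n.natAbs * len g x := by
  rcases Int.natAbs_eq n with h | h
  · conv_lhs => rw [h, zpow_natCast]
    exact len_pow_le x n.natAbs
  · conv_lhs => rw [h, zpow_neg, zpow_natCast, len_inv]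
    exact len_pow_le x n.natAbs

end basics

section prods
variable {X : Type*} [Group X]

/-- `c₀ c₁ ⋯ c_{k-1}` -/
def Ap (c : ℕ → X) : ℕ → X
  | 0 => 1
  | k + 1 => Ap c k * c k

/-- `c_{k-1} ⋯ c₁ c₀` -/
def Rb (c : ℕ → X) : ℕ → X
  | 0 => 1
  | k + 1 => c k * Rb c k

/-- extension of a family by `1` -/
def ext {n : ℕ} (f : Fin n → X) (k : ℕ) : X := if h : k < n then f ⟨k, h⟩ else 1

lemma ofFn_prod (n : ℕ) (f : Fin n → X) (c : ℕ → X) (h : ∀ i : Fin n, c i = f i) :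
    (List.ofFn f).prod = Ap c n := by
  induction n with
  | zero => simp [Ap]
  | succ n ih =>
    rw [List.ofFn_succ_last, List.prod_append, ih (fun i => f i.castSucc) (fun i => h i.castSucc)]
    simp [Ap, ← h]

lemma ofFn_inv_prod (n : ℕ) (f : Fin n → X) (c : ℕ → X) (h : ∀ i : Fin n, c i = f i) :
    (List.ofFn fun i => (f i)⁻¹).prod = (Rb c n)⁻¹ := by
  induction n with
  | zero => simp [Rb]
  | succ n ih =>
    rw [List.ofFn_succ_last, List.prod_append, ih (fun i => f i.castSucc) (fun i => h i.castSucc)]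
    simp [Rb, ← h]

lemma lift_relator {g : ℕ} (f : Fin (2 * g) → X) :
    FreeGroup.lift f (relator g) = Ap (ext f) (2 * g) * (Rb (ext f) (2 * g))⁻¹ := by
  have h : ∀ i : Fin (2 * g), ext f i = f i := fun i => by simp [ext]
  rw [← ofFn_prod _ f _ h, ← ofFn_inv_prod _ f _ h]
  simp [relator, map_list_prod, List.map_ofFn, Function.comp_def]

lemma Ap_map {Y : Type*} [Group Y] (φ : X →* Y) (c : ℕ → X) (k : ℕ) :
    φ (Ap c k) = Ap (fun i => φ (c i)) k := by
  induction k with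
  | zero => simp [Ap]
  | succ k ih => simp [Ap, ih]

lemma Rb_map {Y : Type*} [Group Y] (φ : X →* Y) (c : ℕ → X) (k : ℕ) :
    φ (Rb c k) = Rb (fun i => φ (c i)) k := by
  induction k with
  | zero => simp [Rb]
  | succ k ih => simp [Rb, ih]

end prods

section grp
variable (g : ℕ)

/-- generators indexed by naturals -/
def c (k : ℕ) : SurfaceGroup g := ext (gen g) k

/-- partial products -/
def A (k : ℕ) : SurfaceGroup g := Ap (c g) k
/-- reversed partial products -/
def R (k : ℕ) : SurfaceGroup g := Rb (c g) k

lemma A_zero : A g 0 = 1 := rfl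
lemma R_zero : R g 0 = 1 := rfl
lemma A_succ (k : ℕ) : A g (k + 1) = A g k * c g k := rfl
lemma R_succ (k : ℕ) : R g (k + 1) = c g k * R g k := rfl

lemma A_eq_R : A g (2 * g) = R g (2 * g) := by
  have h : PresentedGroup.mk {relator g} (relator g) = 1 := PresentedGroup.one_of_mem rfl
  have h2 : PresentedGroup.mk {relator g} (relator g) = FreeGroup.lift (gen g) (relator g) := by
    congr 1
    apply FreeGroup.ext_hom
    intro a
    simp [gen, PresentedGroup.of]
  rw [h2, lift_relator] at h
  exact mul_inv_eq_one.1 h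

/-- Universal property. -/
lemma exists_hom {X : Type*} [Group X] (f : ℕ → X) (hf : Ap f (2 * g) = Rb f (2 * g)) :
    ∃ φ : SurfaceGroup g →* X, ∀ k < 2 * g, φ (c g k) = f k := by
  let f' : Fin (2 * g) → X := fun i => f i
  have h1 : ∀ n ≤ 2 * g, Ap (ext f') n = Ap f n ∧ Rb (ext f') n = Rb f n := by
    intro n
    induction n with
    | zero => simp [Ap, Rb]
    | succ n ih =>
      intro hn
      have := ih (by omega)
      simp only [Ap, Rb, this]
      have : ext f' n = f n := by simp [ext, f', show n < 2 * g by omega]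
      simp [this]
  have hr : ∀ r ∈ ({relator g} : Set (FreeGroup (Fin (2 * g)))), FreeGroup.lift f' r = 1 := by
    rintro r rfl
    rw [lift_relator, (h1 _ le_rfl).1, (h1 _ le_rfl).2, hf, mul_inv_cancel]
  refine ⟨PresentedGroup.toGroup hr, fun k hk => ?_⟩
  simp only [c, ext, hk, dif_pos, gen]
  rw [PresentedGroup.toGroup.of]

variable {g}
lemma evalLetter_cases (a : Letter g) :
    ∃ k < 2 * g, evalLetter g a = c g k ∨ evalLetter g a = (c g k)⁻¹ := by
  rcases a with ⟨i, b⟩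
  refine ⟨i, i.2, ?_⟩
  cases b <;> simp [evalLetter, c, ext]

lemma len_c (k : ℕ) : len g (c g k) ≤ 1 := by
  unfold c ext
  split
  · rename_i h
    have := len_letter (g := g) (⟨k, h⟩, true)
    simpa [evalLetter] using this
  · simp [len_one]

lemma grp_induction {P : SurfaceGroup g → Prop} (x : SurfaceGroup g) (h1 : P 1)
    (h2 : ∀ y, ∀ k < 2 * g, P y → P (y * c g k))
    (h3 : ∀ y, ∀ k < 2 * g, P y → P (y * (c g k)⁻¹)) : P x := by
  obtain ⟨W, rfl⟩ := exists_word x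
  induction W using List.reverseRecOn with
  | nil => exact h1
  | append_singleton W a ih =>
    rw [eval_append, eval_singleton]
    obtain ⟨k, hk, h | h⟩ := evalLetter_cases a
    · rw [h]; exact h2 _ k hk ih
    · rw [h]; exact h3 _ k hk ih

/-! abelianization -/

lemma exists_ab (g j : ℕ) : ∃ φ : SurfaceGroup g →* Multiplicative ℤ,
    ∀ k < 2 * g, φ (c g k) = Multiplicative.ofAdd (if k = j then 1 else 0) := by
  apply exists_hom
  generalize 2 * g = n
  induction n with
  | zero => rfl
  | succ n ih => rw [Ap, Rb, ih, mul_comm]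

/-- exponent sum of `c_j` -/
noncomputable def al (j : ℕ) (x : SurfaceGroup g) : ℤ := ((exists_ab g j).choose x).toAdd

lemma al_one (j : ℕ) : al j (1 : SurfaceGroup g) = 0 := by simp [al]
lemma al_mul (j : ℕ) (x y : SurfaceGroup g) : al j (x * y) = al j x + al j y := by simp [al]
lemma al_inv (j : ℕ) (x : SurfaceGroup g) : al j x⁻¹ = - al j x := by simp [al]
lemma al_zpow (j : ℕ) (x : SurfaceGroup g) (n : ℤ) : al j (x ^ n) = n * al j x := by simp [al]
lemma al_pow (j : ℕ) (x : SurfaceGroup g) (n : ℕ) : al j (x ^ n) = n * al j x := by simp [al]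
lemma al_c (j k : ℕ) (hk : k < 2 * g) : al j (c g k) = if k = j then 1 else 0 := by
  rw [al, (exists_ab g j).choose_spec k hk]; rfl

lemma al_A (j k : ℕ) (hk : k ≤ 2 * g) : al j (A g k) = if j < k then 1 else 0 := by
  induction k with
  | zero => simp [A_zero, al_one]
  | succ k ih =>
    rw [A_succ, al_mul, ih (by omega), al_c _ _ (by omega)]
    split_ifs <;> omega

lemma al_R (j k : ℕ) (hk : k ≤ 2 * g) : al j (R g k) = if j < k then 1 else 0 := by
  induction k with
  | zero => simp [R_zero, al_one]
  | succ k ih =>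
    rw [R_succ, al_mul, ih (by omega), al_c _ _ (by omega)]
    split_ifs <;> omega

lemma sum_al_le (x : SurfaceGroup g) : ∑ j ∈ Finset.range (2 * g), |al j x| ≤ len g x := by
  obtain ⟨W, hW, rfl⟩ := len_spec x
  rw [← hW]
  clear hW
  induction W using List.reverseRecOn with
  | nil => simp [eval_nil, al_one]
  | append_singleton W a ih =>
    rw [eval_append, eval_singleton]
    have key : ∑ j ∈ Finset.range (2 * g), |al j (evalLetter g a)| = 1 := by
      obtain ⟨k, hk, h | h⟩ := evalLetter_cases a
      · rw [h, Finset.sum_eq_single k]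
        · simp [al_c _ _ hk]
        · intro b _ hb; simp [al_c _ _ hk, hb.symm]
        · simp [hk]
      · rw [h, Finset.sum_eq_single k]
        · simp [al_inv, al_c _ _ hk]
        · intro b _ hb; simp [al_inv, al_c _ _ hk, hb.symm]
        · simp [hk]
    calc _ ≤ ∑ j ∈ Finset.range (2 * g), (|al j (eval g W)| + |al j (evalLetter g a)|) := by
          apply Finset.sum_le_sum
          intro j _
          rw [al_mul]; exact abs_add_le _ _
      _ ≤ _ := by
          rw [Finset.sum_add_distrib, key]; push_cast [List.length_append, List.length_singleton]; omega

lemma len_parity (x : SurfaceGroup g) :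
    ∃ m : ℤ, (len g x : ℤ) = ∑ j ∈ Finset.range (2 * g), al j x + 2 * m := by
  obtain ⟨W, hW, rfl⟩ := len_spec x
  rw [← hW]
  clear hW
  induction W using List.reverseRecOn with
  | nil => exact ⟨0, by simp [eval_nil, al_one]⟩
  | append_singleton W a ih =>
    obtain ⟨m, hm⟩ := ih
    rw [eval_append, eval_singleton]
    simp only [al_mul, Finset.sum_add_distrib, List.length_append, List.length_singleton]
    push_cast
    obtain ⟨k, hk, h | h⟩ := evalLetter_cases a
    · refine ⟨m, ?_⟩
      have : ∑ j ∈ Finset.range (2 * g), al j (evalLetter g a) = 1 := by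
        rw [h, Finset.sum_eq_single k]
        · simp [al_c _ _ hk]
        · intro b _ hb; simp [al_c _ _ hk, hb.symm]
        · simp [hk]
      omega
    · refine ⟨m + 1, ?_⟩
      have : ∑ j ∈ Finset.range (2 * g), al j (evalLetter g a) = -1 := by
        rw [h, Finset.sum_eq_single k]
        · simp [al_inv, al_c _ _ hk]
        · intro b _ hb; simp [al_inv, al_c _ _ hk, hb.symm]
        · simp [hk]
      omega

end grp

section walls
variable {g : ℕ}

/-- generator of the stabiliser of the base wall of type `i` -/
def y (g i : ℕ) : SurfaceGroup g := R g (2 * g) * (R g (i + 1))⁻¹ * (A g i)⁻¹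

lemma al_y (j i : ℕ) (hj : j < 2 * g) (hi : i < 2 * g) :
    al j (y g i) = if i < j then 1 else if j < i then -1 else 0 := by
  rw [y, al_mul, al_mul, al_inv, al_inv, al_R _ _ le_rfl, al_R _ _ (by omega), al_A _ _ (by omega)]
  split_ifs <;> omega

/-- affine maps -/
def aff {G : Type*} [Group G] (x : G) (d : G → ZMod 2) : Equiv.Perm (G → ZMod 2) where
  toFun f := fun k => f (x⁻¹ * k) + d k
  invFun f := fun k => f (x * k) - d (x * k)
  left_inv f := by ext k; simp
  right_inv f := by ext k; simp

lemma aff_mul {G : Type*} [Group G] (x z : G) (d e : G → ZMod 2) :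
    aff x d * aff z e = aff (x * z) (fun k => e (x⁻¹ * k) + d k) := by
  ext f k
  simp [aff, mul_assoc, add_assoc]

lemma aff_inv {G : Type*} [Group G] (x : G) (d : G → ZMod 2) :
    (aff x d)⁻¹ = aff x⁻¹ (fun k => - d (x * k)) := by
  rw [inv_eq_iff_mul_eq_one, aff_mul]
  ext f k
  simp [aff, CharTwo.add_self_eq_zero]

lemma aff_one {G : Type*} [Group G] : aff (1 : G) (fun _ => 0) = 1 := by
  ext f k
  simp [aff]

/-- membership in the stabiliser of the base wall -/
def St (g i : ℕ) (x : SurfaceGroup g) : Prop := ∃ n : ℤ, x = (y g i) ^ n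

lemma St_inv {i : ℕ} {x : SurfaceGroup g} : St g i x⁻¹ ↔ St g i x := by
  constructor
  · rintro ⟨n, h⟩; exact ⟨-n, by rw [zpow_neg, ← h, inv_inv]⟩
  · rintro ⟨n, h⟩; exact ⟨-n, by rw [zpow_neg, ← h]⟩

lemma St_y_mul {i : ℕ} {x : SurfaceGroup g} (n : ℤ) : St g i ((y g i) ^ n * x) ↔ St g i x := by
  constructor
  · rintro ⟨m, h⟩; exact ⟨-n + m, by rw [zpow_add, ← h]; group⟩
  · rintro ⟨m, h⟩; exact ⟨n + m, by rw [zpow_add, ← h]⟩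

lemma St_mul_y {i : ℕ} {x : SurfaceGroup g} (n : ℤ) : St g i (x * (y g i) ^ n) ↔ St g i x := by
  constructor
  · rintro ⟨m, h⟩; exact ⟨m - n, by rw [zpow_sub, ← h]; group⟩
  · rintro ⟨m, h⟩; exact ⟨m + n, by rw [zpow_add, ← h]⟩

open Classical in
lemma exists_Phi (g i : ℕ) (hi : i < 2 * g) :
    ∃ φ : SurfaceGroup g →* Equiv.Perm (SurfaceGroup g → ZMod 2),
    ∀ k < 2 * g, φ (c g k) =
      aff (c g k) (fun x => if k = i ∧ St g i (A g i * x) then 1 else 0) := by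
  apply exists_hom
  set f : ℕ → Equiv.Perm (SurfaceGroup g → ZMod 2) := fun k =>
    aff (c g k) (fun x => if k = i ∧ St g i (A g i * x) then 1 else 0) with hf
  have h1 : ∀ k, Ap f k = aff (A g k) (fun x => if i < k ∧ St g i x then 1 else 0) := by
    intro k
    induction k with
    | zero => simp [Ap, A_zero, aff_one]
    | succ k ih =>
      rw [Ap, ih, hf, aff_mul, A_succ]
      congr 1
      ext x
      by_cases hk : k = i
      · subst hk; simp
      · simp [hk, show i < k + 1 ↔ i < k by omega]
  have h2 : ∀ k, Rb f k = aff (R g k)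
      (fun x => if i < k ∧ St g i (A g i * R g (i + 1) * (R g k)⁻¹ * x) then 1 else 0) := by
    intro k
    induction k with
    | zero => simp [Rb, R_zero, aff_one]
    | succ k ih =>
      rw [Rb, ih, hf, aff_mul, ← R_succ]
      congr 1
      ext x
      by_cases hk : k = i
      · subst hk
        have : A g k * R g (k + 1) * (R g (k + 1))⁻¹ * x = A g k * x := by group
        simp [this]
      · have : (R g (k + 1))⁻¹ * x = (R g k)⁻¹ * ((c g k)⁻¹ * x) := by rw [R_succ]; group
        simp only [mul_assoc, this]
        simp [hk, show i < k + 1 ↔ i < k by omega]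
  rw [h1, h2, A_eq_R]
  congr 1
  ext x
  have : A g i * R g (i + 1) * (R g (2 * g))⁻¹ = (y g i) ^ (-1 : ℤ) := by
    simp [y, mul_assoc]
  rw [this, St_y_mul]

/-- height (mod 2) with respect to the base wall of type `i` -/
noncomputable def eta (i : ℕ) (x : SurfaceGroup g) : ZMod 2 :=
  if hi : i < 2 * g then (exists_Phi g i hi).choose x 0 1 else 0

open Classical in
lemma eta_c (i : ℕ) (hi : i < 2 * g) (p : SurfaceGroup g) (k : ℕ) (hk : k < 2 * g) :
    eta i (p * c g k) = eta i p + if k = i ∧ St g i (p * (A g i)⁻¹) then 1 else 0 := by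
  obtain h := (exists_Phi g i hi).choose_spec
  have e : ∀ x : SurfaceGroup g, eta i x = (exists_Phi g i hi).choose x 0 1 := by
    intro x; simp [eta, hi]
  rw [e, e]
  generalize (exists_Phi g i hi).choose = φ at h
  have haff : ∀ x, ∃ d, φ x = aff x d := by
    intro x
    induction x using grp_induction with
    | h1 => exact ⟨_, by rw [map_one, aff_one]⟩
    | h2 z k hk ih =>
      obtain ⟨d, hd⟩ := ih
      exact ⟨_, by rw [map_mul, hd, h k hk, aff_mul]⟩
    | h3 z k hk ih =>
      obtain ⟨d, hd⟩ := ih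
      exact ⟨_, by rw [map_mul, hd, map_inv, h k hk, aff_inv, aff_mul]⟩
  obtain ⟨d, hd⟩ := haff p
  rw [map_mul, hd, h k hk, aff_mul]
  have e1 : A g i * (p⁻¹ * 1) = (p * (A g i)⁻¹)⁻¹ := by group
  have e2 : ∀ (x : SurfaceGroup g) (d' : SurfaceGroup g → ZMod 2), aff x d' 0 1 = d' 1 := by
    intro x d'; simp [aff]
  rw [e2, e2]
  rw [e1, St_inv, add_comm]

lemma eta_one (i : ℕ) : eta i (1 : SurfaceGroup g) = 0 := by
  unfold eta; split <;> simp

open Classical in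
lemma eta_cinv (i : ℕ) (hi : i < 2 * g) (p : SurfaceGroup g) (k : ℕ) (hk : k < 2 * g) :
    eta i (p * (c g k)⁻¹) = eta i p + if k = i ∧ St g i (p * (c g k)⁻¹ * (A g i)⁻¹) then 1 else 0 := by
  have := eta_c i hi (p * (c g k)⁻¹) k hk
  rw [inv_mul_cancel_right] at this
  rw [this, add_assoc, CharTwo.add_self_eq_zero, add_zero]

open Classical in
lemma eta_A (i : ℕ) (hi : i < 2 * g) (p : SurfaceGroup g) (k : ℕ) (hk : k ≤ 2 * g) :
    eta i (p * A g k) = eta i p + if i < k ∧ St g i p then 1 else 0 := by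
  induction k with
  | zero => simp [A_zero]
  | succ k ih =>
    rw [A_succ, ← mul_assoc, eta_c i hi _ k (by omega), ih (by omega)]
    by_cases h : k = i
    · subst h; simp
    · simp [h, show i < k + 1 ↔ i < k by omega]

open Classical in
lemma eta_R (i : ℕ) (hi : i < 2 * g) (p : SurfaceGroup g) (k : ℕ) (hk : k ≤ 2 * g) :
    eta i (p * R g k) = eta i p +
      if i < k ∧ St g i (p * R g k * (R g (i + 1))⁻¹ * (A g i)⁻¹) then 1 else 0 := by
  induction k generalizing p with
  | zero => simp [R_zero]
  | succ k ih =>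
    rw [R_succ, ← mul_assoc, ih _ (by omega), eta_c i hi _ k (by omega)]
    by_cases h : k = i
    · subst h; simp [R_succ]
    · simp [h, show i < k + 1 ↔ i < k by omega, mul_assoc]

open Classical in
/-- heights along the tail segment `c_{N-1} ⋯ c_{j+1}` -/
lemma eta_tail (i j : ℕ) (hi : i < 2 * g) (hj : j < 2 * g) (p : SurfaceGroup g) :
    eta i (p * (R g (2 * g) * (R g (j + 1))⁻¹)) =
      eta i p + if j < i ∧ St g i p then 1 else 0 := by
  have h1 := eta_R i hi p (2 * g) le_rfl
  have h2 := eta_R i hi (p * (R g (2 * g) * (R g (j + 1))⁻¹)) (j + 1) (by omega)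
  have e1 : p * (R g (2 * g) * (R g (j + 1))⁻¹) * R g (j + 1) = p * R g (2 * g) := by group
  have e2 : p * R g (2 * g) * (R g (i + 1))⁻¹ * (A g i)⁻¹ = p * (y g i) ^ (1 : ℤ) := by
    simp [y, mul_assoc]
  rw [e1, e2, St_mul_y] at h2
  rw [e2, St_mul_y] at h1
  rw [h1] at h2
  have h3 : ∀ a b x z : ZMod 2, a + x = b + z → b = a + (x + z) := by decide
  rw [h3 _ _ _ _ h2]
  congr 1
  by_cases hs : St g i p
  · by_cases hji : j < i
    · simp [hs, hi, hji]
    · simp [hs, hi, hji, show i < j + 1 by omega]; decide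
  · simp [hs]

open Classical in
lemma eta_y (i j : ℕ) (hi : i < 2 * g) (hj : j < 2 * g) (p : SurfaceGroup g) :
    eta i (p * y g j) = eta i p + (if j < i ∧ St g i p then 1 else 0)
      + (if i < j ∧ St g i (p * y g j) then 1 else 0) := by
  have h1 := eta_A i hi (p * y g j) j (by omega)
  have e : p * y g j * A g j = p * (R g (2 * g) * (R g (j + 1))⁻¹) := by
    simp [y, mul_assoc]
  rw [e, eta_tail i j hi hj] at h1
  rw [h1, add_assoc, CharTwo.add_self_eq_zero, add_zero]

lemma eta_mul_y_self (i : ℕ) (hi : i < 2 * g) (p : SurfaceGroup g) :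
    eta i (p * y g i) = eta i p := by
  rw [eta_y i i hi hi]; simp

end walls
end SGP

namespace SGP
open SG Pointwise

section hs
variable {g : ℕ}

lemma eta_mul_zpow_self (i : ℕ) (hi : i < 2 * g) (p : SurfaceGroup g) (n : ℤ) :
    eta i (p * y g i ^ n) = eta i p := by
  induction n using Int.induction_on with
  | zero => simp
  | succ n ih => rw [zpow_add_one, ← mul_assoc, eta_mul_y_self i hi, ih]
  | pred n ih =>
    have := eta_mul_y_self i hi (p * y g i ^ (-(n : ℤ) - 1))
    rw [mul_assoc, ← zpow_add_one, sub_add_cancel, ih] at this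
    exact this.symm

lemma eta_zpow_mul (i : ℕ) (hi : i < 2 * g) (p : SurfaceGroup g) (n : ℤ) :
    eta i (y g i ^ n * p) = eta i p := by
  induction p using grp_induction with
  | h1 => have := eta_mul_zpow_self i hi 1 n; simpa using this
  | h2 z k hk ih =>
    rw [← mul_assoc, eta_c i hi _ k hk, eta_c i hi _ k hk, ih, mul_assoc, St_y_mul]
  | h3 z k hk ih =>
    rw [← mul_assoc, eta_cinv i hi _ k hk, eta_cinv i hi _ k hk, ih]
    have : y g i ^ n * z * (c g k)⁻¹ * (A g i)⁻¹ = y g i ^ n * (z * (c g k)⁻¹ * (A g i)⁻¹) := by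
      group
    rw [this, St_y_mul]

/-- half-space of type `i` -/
def H (i : ℕ) (k : SurfaceGroup g) : Set (SurfaceGroup g) := {p | eta i (k⁻¹ * p) = 1}

/-- being a half-space of type `i` -/
def HS (i : ℕ) (S : Set (SurfaceGroup g)) : Prop :=
  i < 2 * g ∧ ∃ k : SurfaceGroup g, S = H i k ∨ S = (H i k)ᶜ

lemma HS.lt {i : ℕ} {S : Set (SurfaceGroup g)} (h : HS i S) : i < 2 * g := h.1

lemma mem_smul (u : SurfaceGroup g) (S : Set (SurfaceGroup g)) (p : SurfaceGroup g) :
    p ∈ u • S ↔ u⁻¹ * p ∈ S := by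
  rw [Set.mem_smul_set_iff_inv_smul_mem]; rfl

lemma smul_H (u : SurfaceGroup g) (i : ℕ) (k : SurfaceGroup g) : u • H i k = H i (u * k) := by
  ext p
  rw [mem_smul]; simp [H, mul_assoc]

lemma smul_compl (u : SurfaceGroup g) (S : Set (SurfaceGroup g)) : u • Sᶜ = (u • S)ᶜ :=
  Set.smul_set_compl

lemma HS.compl {i : ℕ} {S : Set (SurfaceGroup g)} (h : HS i S) : HS i Sᶜ := by
  obtain ⟨hi, k, rfl | rfl⟩ := h
  · exact ⟨hi, k, Or.inr rfl⟩
  · exact ⟨hi, k, Or.inl (compl_compl _)⟩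

lemma HS.smul {i : ℕ} {S : Set (SurfaceGroup g)} (h : HS i S) (u : SurfaceGroup g) :
    HS i (u • S) := by
  obtain ⟨hi, k, rfl | rfl⟩ := h
  · exact ⟨hi, u * k, Or.inl (smul_H _ _ _)⟩
  · exact ⟨hi, u * k, Or.inr (by rw [smul_compl, smul_H])⟩

lemma H_congr {i : ℕ} (hi : i < 2 * g) {k l : SurfaceGroup g} (h : St g i (k⁻¹ * l)) :
    H i k = H i l := by
  obtain ⟨n, hn⟩ := h
  have : l = k * y g i ^ n := by rw [← hn]; group
  subst this
  ext p
  have : (k * y g i ^ n)⁻¹ * p = y g i ^ (-n) * (k⁻¹ * p) := by group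
  simp only [H, Set.mem_ofPred_eq]
  rw [this, eta_zpow_mul i hi]

lemma edge_H {i m : ℕ} (hi : i < 2 * g) (hm : m < 2 * g) (k p : SurfaceGroup g) :
    ¬ (p ∈ H i k ↔ p * c g m ∈ H i k) ↔ (m = i ∧ St g i (k⁻¹ * (p * (A g i)⁻¹))) := by
  classical
  simp only [H, Set.mem_ofPred_eq]
  have h := eta_c i hi (k⁻¹ * p) m hm
  rw [mul_assoc] at h
  rw [h]
  rw [show k⁻¹ * p * (A g i)⁻¹ = k⁻¹ * (p * (A g i)⁻¹) by group]
  by_cases hc : m = i ∧ St g i (k⁻¹ * (p * (A g i)⁻¹))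
  · rw [if_pos hc]
    simp only [hc, iff_true]
    generalize eta i (k⁻¹ * p) = a
    revert a; decide
  · rw [if_neg hc]; simp [hc]

lemma edge_HS {i m : ℕ} {S : Set (SurfaceGroup g)} (hS : HS i S) (hm : m < 2 * g)
    (p : SurfaceGroup g) (h : ¬ (p ∈ S ↔ p * c g m ∈ S)) :
    m = i ∧ (S = H i (p * (A g i)⁻¹) ∨ S = (H i (p * (A g i)⁻¹))ᶜ) := by
  obtain ⟨hi, k, rfl | rfl⟩ := hS
  · rw [edge_H hi hm] at h
    exact ⟨h.1, Or.inl (H_congr hi h.2)⟩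
  · rw [Set.mem_compl_iff, Set.mem_compl_iff, not_iff_not, edge_H hi hm] at h
    exact ⟨h.1, Or.inr (by rw [H_congr hi h.2])⟩

lemma edge_self {i : ℕ} (hi : i < 2 * g) (k : SurfaceGroup g) :
    ¬ (k * A g i ∈ H i k ↔ k * A g i * c g i ∈ H i k) := by
  rw [edge_H hi hi]
  exact ⟨rfl, 0, by group⟩

lemma HS_cases {i j : ℕ} {k l : SurfaceGroup g} (hi : i < 2 * g) (hj : j < 2 * g)
    (h : H i k = H j l ∨ H i k = (H j l)ᶜ) : i = j ∧ St g i (k⁻¹ * l) ∧ H i k = H j l := by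
  have h1 : ¬ (k * A g i ∈ H j l ↔ k * A g i * c g i ∈ H j l) := by
    have := edge_self hi k
    rcases h with h | h
    · rw [h] at this; exact this
    · rw [h, Set.mem_compl_iff, Set.mem_compl_iff, not_iff_not] at this; exact this
  rw [edge_H hj hi] at h1
  obtain ⟨rfl, h1⟩ := h1
  rw [mul_inv_cancel_right] at h1
  have h2 : St g i (k⁻¹ * l) := by
    rw [← St_inv]; simpa using h1
  exact ⟨rfl, h2, H_congr hi h2⟩

lemma HS.type_unique {i j : ℕ} {S : Set (SurfaceGroup g)} (h1 : HS i S) (h2 : HS j S) : i = j := by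
  obtain ⟨hi, k, rfl | rfl⟩ := h1 <;> obtain ⟨hj, l, h | h⟩ := h2
  · exact (HS_cases hi hj (Or.inl h)).1
  · exact (HS_cases hi hj (Or.inr h)).1
  · exact (HS_cases hi hj (Or.inr (by rw [← h, compl_compl]))).1
  · exact (HS_cases hi hj (Or.inl (compl_injective h))).1

lemma HS.smul_cases {i : ℕ} {S : Set (SurfaceGroup g)} (hS : HS i S) {u : SurfaceGroup g}
    (h : u • S = S ∨ u • S = Sᶜ) : u • S = S ∧ ∃ (k : SurfaceGroup g) (m : ℤ),
      u = k * y g i ^ m * k⁻¹ := by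
  obtain ⟨hi, k, rfl | rfl⟩ := hS
  · rw [smul_H] at *
    obtain ⟨_, ⟨n, h1⟩, h2⟩ := HS_cases hi hi h
    exact ⟨h2, k, -n, by rw [zpow_neg, ← h1]; group⟩
  · rw [smul_compl, smul_H] at *
    have h' : H i (u * k) = H i k ∨ H i (u * k) = (H i k)ᶜ := by
      rcases h with h | h
      · left; exact compl_injective h
      · right; exact compl_injective h
    obtain ⟨_, ⟨n, h1⟩, h2⟩ := HS_cases hi hi h'
    exact ⟨by rw [h2], k, -n, by rw [zpow_neg, ← h1]; group⟩

lemma HS.smul_ne_compl {i : ℕ} {S : Set (SurfaceGroup g)} (hS : HS i S) (u : SurfaceGroup g) :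
    u • S ≠ Sᶜ := by
  intro h
  have := (hS.smul_cases (Or.inr h)).1
  rw [this] at h
  have h1 : (1 : SurfaceGroup g) ∈ S ↔ (1 : SurfaceGroup g) ∈ Sᶜ := by rw [← h]
  simp at h1

/-! lengths -/

lemma len_A (k : ℕ) : len g (A g k) ≤ k := by
  induction k with
  | zero => simp [A_zero, len_one]
  | succ k ih =>
    rw [A_succ]
    have := len_mul (A g k) (c g k)
    have := len_c (g := g) k
    omega

lemma len_R (k : ℕ) : len g (R g k) ≤ k := by
  induction k with
  | zero => simp [R_zero, len_one]
  | succ k ih =>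
    rw [R_succ]
    have := len_mul (c g k) (R g k)
    have := len_c (g := g) k
    omega

lemma len_AA (k d : ℕ) : len g ((A g k)⁻¹ * A g (k + d)) ≤ d := by
  induction d with
  | zero => simp [len_one]
  | succ d ih =>
    rw [← add_assoc, A_succ, ← mul_assoc]
    have := len_mul ((A g k)⁻¹ * A g (k + d)) (c g (k + d))
    have := len_c (g := g) (k + d)
    omega

lemma len_RR (k d : ℕ) : len g (R g (k + d) * (R g k)⁻¹) ≤ d := by
  induction d with
  | zero => simp [len_one]
  | succ d ih =>
    rw [← add_assoc, R_succ, mul_assoc]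
    have := len_mul (c g (k + d)) (R g (k + d) * (R g k)⁻¹)
    have := len_c (g := g) (k + d)
    omega

lemma len_B (i : ℕ) (hi : i < 2 * g) : len g ((A g i)⁻¹ * y g i * A g i) ≤ 2 * g - 1 := by
  obtain ⟨d, hd⟩ : ∃ d, 2 * g = i + 1 + d := ⟨2 * g - (i + 1), by omega⟩
  have e : (A g i)⁻¹ * y g i * A g i = (A g i)⁻¹ * (R g (2 * g) * (R g (i + 1))⁻¹) := by
    simp [y, mul_assoc]
  have h1 := len_RR (g := g) (i + 1) d
  rw [← hd] at h1
  have h2 := len_mul (A g i)⁻¹ (R g (2 * g) * (R g (i + 1))⁻¹)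
  have h3 := len_A (g := g) i
  rw [len_inv, ← e] at h2
  omega

lemma len_F (i : ℕ) (hi : i < 2 * g) :
    len g ((A g i * c g i)⁻¹ * y g i * (A g i * c g i)) ≤ 2 * g - 1 := by
  obtain ⟨d, hd⟩ : ∃ d, 2 * g = i + 1 + d := ⟨2 * g - (i + 1), by omega⟩
  have e : (A g i * c g i)⁻¹ * y g i * (A g i * c g i) =
      ((A g (i + 1))⁻¹ * A g (2 * g)) * (R g i)⁻¹ := by
    rw [A_eq_R, A_succ]
    simp only [y, R_succ g i]
    group
  have h1 := len_AA (g := g) (i + 1) d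
  rw [← hd] at h1
  have h2 := len_mul ((A g (i + 1))⁻¹ * A g (2 * g)) (R g i)⁻¹
  have h3 := len_R (g := g) i
  rw [len_inv, ← e] at h2
  omega

lemma sum_y (i : ℕ) (hi : i < 2 * g) (m : ℤ) (x : SurfaceGroup g)
    (hx : ∀ j < 2 * g, j ≠ i → al j x = m * al j (y g i)) :
    |m| * (2 * g - 1) + |al i x| ≤ len g x := by
  refine le_trans (le_of_eq ?_) (sum_al_le x)
  rw [← Finset.add_sum_erase _ _ (Finset.mem_range.2 hi), add_comm]
  congr 1
  have : ∀ j ∈ (Finset.range (2 * g)).erase i, |al j x| = |m| := by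
    intro j hj
    simp only [Finset.mem_erase, Finset.mem_range] at hj
    rw [hx j hj.2 hj.1, al_y j i hj.2 hi, abs_mul]
    rcases lt_trichotomy i j with h | h | h
    · simp [h]
    · omega
    · simp [h, show ¬ i < j by omega]
  rw [Finset.sum_congr rfl this, Finset.sum_const, Finset.card_erase_of_mem (Finset.mem_range.2 hi),
    Finset.card_range, nsmul_eq_mul, Nat.cast_sub (by omega)]
  push_cast; ring

/-- distance -/
noncomputable def dd (p q : SurfaceGroup g) : ℕ := len g (p⁻¹ * q)

lemma dd_comm (p q : SurfaceGroup g) : dd p q = dd q p := by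
  rw [dd, ← len_inv, dd]; simp

lemma dd_tri (p q r : SurfaceGroup g) : dd p r ≤ dd p q + dd q r := by
  have := len_mul (p⁻¹ * q) (q⁻¹ * r)
  rw [show p⁻¹ * q * (q⁻¹ * r) = p⁻¹ * r by group] at this
  exact this

lemma dd_left (u p q : SurfaceGroup g) : dd (u * p) (u * q) = dd p q := by
  unfold dd; congr 1; group

lemma ladder {i : ℕ} (hi : i < 2 * g) (k : SurfaceGroup g) (a b : ℤ) :
    ∃ M : ℕ, dd (k * y g i ^ a * A g i) (k * y g i ^ b * A g i) = M ∧
      dd (k * y g i ^ a * A g i * c g i) (k * y g i ^ b * A g i * c g i) = M ∧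
      M + 1 ≤ dd (k * y g i ^ a * A g i) (k * y g i ^ b * A g i * c g i) ∧
      M + 1 ≤ dd (k * y g i ^ a * A g i * c g i) (k * y g i ^ b * A g i) := by
  refine ⟨(b - a).natAbs * (2 * g - 1), ?_⟩
  have hM : (((b - a).natAbs * (2 * g - 1) : ℕ) : ℤ) = |b - a| * (2 * g - 1) := by
    rw [Nat.cast_mul, Nat.cast_sub (by omega)]; simp
  have up1 : dd (k * y g i ^ a * A g i) (k * y g i ^ b * A g i) ≤ (b - a).natAbs * (2 * g - 1) := by
    have e : (k * y g i ^ a * A g i)⁻¹ * (k * y g i ^ b * A g i) =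
        ((A g i)⁻¹ * y g i * ((A g i)⁻¹)⁻¹) ^ (b - a) := by
      rw [conj_zpow]; group
    rw [dd, e]
    refine (len_zpow_le _ _).trans (Nat.mul_le_mul_left _ ?_)
    simpa using len_B i hi
  have up2 : dd (k * y g i ^ a * A g i * c g i) (k * y g i ^ b * A g i * c g i) ≤
      (b - a).natAbs * (2 * g - 1) := by
    have e : (k * y g i ^ a * A g i * c g i)⁻¹ * (k * y g i ^ b * A g i * c g i) =
        ((A g i * c g i)⁻¹ * y g i * ((A g i * c g i)⁻¹)⁻¹) ^ (b - a) := by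
      rw [conj_zpow]; group
    rw [dd, e]
    refine (len_zpow_le _ _).trans (Nat.mul_le_mul_left _ ?_)
    simpa using len_F i hi
  have yi : al i (y g i) = 0 := by rw [al_y i i hi hi]; simp
  have lo1 := sum_y i hi (b - a) ((k * y g i ^ a * A g i)⁻¹ * (k * y g i ^ b * A g i))
    (by intro j _ _; simp only [al_mul, al_inv, al_zpow]; ring)
  have lo2 := sum_y i hi (b - a)
    ((k * y g i ^ a * A g i * c g i)⁻¹ * (k * y g i ^ b * A g i * c g i))
    (by intro j _ _; simp only [al_mul, al_inv, al_zpow]; ring)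
  have lo3 := sum_y i hi (b - a) ((k * y g i ^ a * A g i)⁻¹ * (k * y g i ^ b * A g i * c g i))
    (by
      intro j _ hj; simp only [al_mul, al_inv, al_zpow, al_c j i hi, if_neg hj.symm]; ring)
  have lo4 := sum_y i hi (b - a) ((k * y g i ^ a * A g i * c g i)⁻¹ * (k * y g i ^ b * A g i))
    (by
      intro j _ hj; simp only [al_mul, al_inv, al_zpow, al_c j i hi, if_neg hj.symm]; ring)
  have e3 : al i ((k * y g i ^ a * A g i)⁻¹ * (k * y g i ^ b * A g i * c g i)) = 1 := by
    simp only [al_mul, al_inv, al_zpow, al_c i i hi, yi, if_true]; ring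
  have e4 : al i ((k * y g i ^ a * A g i * c g i)⁻¹ * (k * y g i ^ b * A g i)) = -1 := by
    simp only [al_mul, al_inv, al_zpow, al_c i i hi, yi, if_true]; ring
  rw [e3, ← hM] at lo3
  rw [e4, ← hM] at lo4
  rw [← hM] at lo1 lo2
  have p1 := abs_nonneg (al i ((k * y g i ^ a * A g i)⁻¹ * (k * y g i ^ b * A g i)))
  have p2 := abs_nonneg (al i
    ((k * y g i ^ a * A g i * c g i)⁻¹ * (k * y g i ^ b * A g i * c g i)))
  simp only [abs_neg, abs_one] at lo3 lo4
  unfold dd at *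
  refine ⟨?_, ?_, ?_, ?_⟩ <;> omega

/-- geodesics -/
def Geo (f : ℕ → SurfaceGroup g) (n : ℕ) : Prop :=
  (∀ s t, s ≤ t → t ≤ n → dd (f s) (f t) = t - s) ∧
  (∀ t < n, ∃ j < 2 * g, f (t + 1) = f t * c g j ∨ f t = f (t + 1) * c g j)

lemma exists_geo (p q : SurfaceGroup g) :
    ∃ f : ℕ → SurfaceGroup g, Geo f (dd p q) ∧ f 0 = p ∧ f (dd p q) = q := by
  obtain ⟨W, hW, hWe⟩ := len_spec (p⁻¹ * q)
  have hn : W.length = dd p q := hW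
  rw [← hn]
  set f : ℕ → SurfaceGroup g := fun t => p * eval g (W.take t) with hf
  have f0 : f 0 = p := by simp [hf, eval_nil]
  have fn : f W.length = q := by simp [hf, hWe]
  have up : ∀ s t, s ≤ t → t ≤ W.length → dd (f s) (f t) ≤ t - s := by
    intro s t hst ht
    have e : W.take t = W.take s ++ (W.take t).drop s := by
      conv_lhs => rw [← List.take_append_drop s (W.take t)]
      rw [List.take_take, min_eq_left hst]
    have : (f s)⁻¹ * f t = eval g ((W.take t).drop s) := by
      have e2 : eval g (W.take t) = eval g (W.take s) * eval g ((W.take t).drop s) := by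
        rw [← eval_append, ← e]
      simp only [hf]
      rw [e2]; group
    rw [dd, this]
    refine (len_le _).trans ?_
    simp; omega
  refine ⟨f, ⟨?_, ?_⟩, f0, fn⟩
  · intro s t hst ht
    apply le_antisymm (up s t hst ht)
    have h1 := up 0 s (by omega) (by omega)
    have h2 := up t W.length ht le_rfl
    have h3 := dd_tri (f 0) (f s) (f W.length)
    have h4 := dd_tri (f s) (f t) (f W.length)
    rw [f0, fn] at *
    omega
  · intro t ht
    have e : f (t + 1) = f t * evalLetter g W[t] := by
      simp only [hf]
      rw [← List.take_append_getElem ht, eval_append, eval_singleton, mul_assoc]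
    obtain ⟨j, hj, h | h⟩ := evalLetter_cases W[t]
    · exact ⟨j, hj, Or.inl (by rw [e, h])⟩
    · exact ⟨j, hj, Or.inr (by rw [e, h]; group)⟩

/-- a crossing edge -/
lemma cross_edge {i : ℕ} {k : SurfaceGroup g} (hi : i < 2 * g) {p q : SurfaceGroup g}
    (hpq : ∃ j < 2 * g, q = p * c g j ∨ p = q * c g j) (h : ¬ (p ∈ H i k ↔ q ∈ H i k)) :
    ∃ a : ℤ, (p = k * y g i ^ a * A g i ∧ q = p * c g i) ∨
      (q = k * y g i ^ a * A g i ∧ p = q * c g i) := by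
  obtain ⟨j, hj, rfl | rfl⟩ := hpq
  · rw [edge_H hi hj] at h
    obtain ⟨rfl, a, ha⟩ := h
    refine ⟨a, Or.inl ⟨?_, rfl⟩⟩
    rw [← ha]; group
  · rw [iff_comm, edge_H hi hj] at h
    obtain ⟨rfl, a, ha⟩ := h
    refine ⟨a, Or.inr ⟨?_, rfl⟩⟩
    rw [← ha]; group

lemma once {f : ℕ → SurfaceGroup g} {n : ℕ} (hf : Geo f n) {i : ℕ} {S : Set (SurfaceGroup g)}
    (hS : HS i S) {s t : ℕ} (hst : s < t) (ht : t < n)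
    (h1 : ¬ (f s ∈ S ↔ f (s + 1) ∈ S)) (h2 : ¬ (f t ∈ S ↔ f (t + 1) ∈ S)) : False := by
  obtain ⟨hi, k, hk⟩ := hS
  have h1' : ¬ (f s ∈ H i k ↔ f (s + 1) ∈ H i k) := by
    rcases hk with rfl | rfl
    · exact h1
    · simpa only [Set.mem_compl_iff, not_iff_not] using h1
  have h2' : ¬ (f t ∈ H i k ↔ f (t + 1) ∈ H i k) := by
    rcases hk with rfl | rfl
    · exact h2
    · simpa only [Set.mem_compl_iff, not_iff_not] using h2
  obtain ⟨a, ha⟩ := cross_edge hi (hf.2 s (by omega)) h1'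
  obtain ⟨b, hb⟩ := cross_edge hi (hf.2 t ht) h2'
  obtain ⟨M, l1, l2, l3, l4⟩ := ladder hi k a b
  have d1 := hf.1 s t (by omega) (by omega)
  have d2 := hf.1 s (t + 1) (by omega) (by omega)
  have d3 := hf.1 (s + 1) t (by omega) (by omega)
  have d4 := hf.1 (s + 1) (t + 1) (by omega) (by omega)
  rcases ha with ⟨ha, ha'⟩ | ⟨ha, ha'⟩ <;> rcases hb with ⟨hb, hb'⟩ | ⟨hb, hb'⟩ <;>
    simp only [← ha, ← ha', ← hb, ← hb'] at l1 l2 l3 l4 <;> omega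

lemma ivt {Q : ℕ → Prop} {a b : ℕ} (hab : a ≤ b) (h : ¬ (Q a ↔ Q b)) :
    ∃ t, a ≤ t ∧ t < b ∧ ¬ (Q t ↔ Q (t + 1)) := by
  by_contra hc
  push Not at hc
  apply h
  clear h
  induction b, hab using Nat.le_induction with
  | base => rfl
  | succ b hab ih =>
    rw [ih (fun t h1 h2 => hc t h1 (by omega))]
    exact hc b hab (by omega)

lemma conv {f : ℕ → SurfaceGroup g} {n : ℕ} (hf : Geo f n) {i : ℕ} {S : Set (SurfaceGroup g)}
    (hS : HS i S) (h0 : f 0 ∈ S) (hn : f n ∈ S) {t : ℕ} (ht : t ≤ n) : f t ∈ S := by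
  by_contra hc
  obtain ⟨a, _, ha, ha'⟩ := ivt (Q := fun t => f t ∈ S) (Nat.zero_le t) (by simp [h0, hc])
  obtain ⟨b, hb, hb1, hb'⟩ := ivt (Q := fun t => f t ∈ S) ht (by simp [hn, hc])
  exact once hf hS (show a < b by omega) hb1 ha' hb'

/-- half-spaces separating `p` from `q` -/
def sep (p q : SurfaceGroup g) : Set (Set (SurfaceGroup g)) :=
  {S | (∃ i, HS i S) ∧ p ∈ S ∧ q ∉ S}

lemma sep_fin_edge (p : SurfaceGroup g) (k : ℕ) (hk : k < 2 * g) :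
    ∃ S, sep p (p * c g k) ⊆ {S} ∧ sep (p * c g k) p ⊆ {Sᶜ} := by
  have key : ∀ S, (∃ i, HS i S) → ¬ (p ∈ S ↔ p * c g k ∈ S) →
      S = H k (p * (A g k)⁻¹) ∨ S = (H k (p * (A g k)⁻¹))ᶜ := by
    rintro S ⟨i, hS⟩ h
    obtain ⟨rfl, h⟩ := edge_HS hS hk p h
    exact h
  by_cases hp : p ∈ H k (p * (A g k)⁻¹)
  · refine ⟨H k (p * (A g k)⁻¹), ?_, ?_⟩
    · rintro S ⟨h1, h2, h3⟩
      rcases key S h1 (by simp [h2, h3]) with h | h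
      · exact h
      · rw [h] at h2; exact absurd hp h2
    · rintro S ⟨h1, h2, h3⟩
      rcases key S h1 (by simp [h2, h3]) with h | h
      · rw [h] at h3; exact absurd hp h3
      · exact h
  · refine ⟨(H k (p * (A g k)⁻¹))ᶜ, ?_, ?_⟩
    · rintro S ⟨h1, h2, h3⟩
      rcases key S h1 (by simp [h2, h3]) with h | h
      · rw [h] at h2; exact absurd h2 hp
      · exact h
    · rintro S ⟨h1, h2, h3⟩
      rcases key S h1 (by simp [h2, h3]) with h | h
      · rw [compl_compl]; exact h
      · rw [h] at h3; exact absurd hp h3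

lemma sep_tri (p q r : SurfaceGroup g) : sep p r ⊆ sep p q ∪ sep q r := by
  rintro S ⟨h1, h2, h3⟩
  by_cases h : q ∈ S
  · exact Or.inr ⟨h1, h, h3⟩
  · exact Or.inl ⟨h1, h2, h⟩

lemma sep_finite (p q : SurfaceGroup g) : (sep p q).Finite := by
  have : ∀ x : SurfaceGroup g, (sep p (p * x)).Finite := by
    intro x
    induction x using grp_induction with
    | h1 =>
      have : sep p (p * 1) = ∅ := by
        ext S; simp [sep]
      rw [this]; exact Set.finite_empty
    | h2 z k hk ih =>
      obtain ⟨S, hS, _⟩ := sep_fin_edge (p * z) k hk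
      rw [← mul_assoc]
      exact (ih.union ((Set.finite_singleton S).subset hS)).subset (sep_tri p (p * z) _)
    | h3 z k hk ih =>
      obtain ⟨S, _, hS⟩ := sep_fin_edge (p * z * (c g k)⁻¹) k hk
      rw [inv_mul_cancel_right] at hS
      rw [← mul_assoc]
      exact (ih.union ((Set.finite_singleton _).subset hS)).subset (sep_tri p (p * z) _)
  simpa using this (p⁻¹ * q)

lemma sep_card (p q : SurfaceGroup g) : (sep p q).ncard = dd p q := by
  obtain ⟨f, hf, f0, fn⟩ := exists_geo p q
  generalize dd p q = n at *
  subst f0 fn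
  apply le_antisymm
  · -- each separating half-space is crossed
    have : ∀ m ≤ n, (sep (f 0) (f m)).ncard ≤ m := by
      intro m
      induction m with
      | zero =>
        intro _
        have : sep (f 0) (f 0) = ∅ := by ext S; simp [sep]
        simp [this]
      | succ m ih =>
        intro hm
        have h1 := ih (by omega)
        have h2 : (sep (f m) (f (m + 1))).ncard ≤ 1 := by
          obtain ⟨j, hj, h | h⟩ := hf.2 m (by omega)
          · obtain ⟨S, hS, _⟩ := sep_fin_edge (f m) j hj
            rw [← h] at hS
            exact (Set.ncard_le_ncard hS).trans (by simp)
          · obtain ⟨S, _, hS⟩ := sep_fin_edge (f (m + 1)) j hj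
            rw [← h] at hS
            exact (Set.ncard_le_ncard hS).trans (by simp)
        have h3 := Set.ncard_le_ncard (sep_tri (f 0) (f m) (f (m + 1)))
          ((sep_finite _ _).union (sep_finite _ _))
        have h4 := Set.ncard_union_le (sep (f 0) (f m)) (sep (f m) (f (m + 1)))
        omega
    exact this n le_rfl
  · have key : ∀ t < n, ∃ S, (∃ i, HS i S) ∧ f t ∈ S ∧ f (t + 1) ∉ S := by
      intro t ht
      have : ∃ S, (∃ i, HS i S) ∧ ¬ (f t ∈ S ↔ f (t + 1) ∈ S) := by
        obtain ⟨j, hj, h | h⟩ := hf.2 t ht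
        · refine ⟨H j (f t * (A g j)⁻¹), ⟨j, hj, _, Or.inl rfl⟩, ?_⟩
          have := edge_self hj (f t * (A g j)⁻¹)
          rw [inv_mul_cancel_right, ← h] at this
          exact this
        · refine ⟨H j (f (t + 1) * (A g j)⁻¹), ⟨j, hj, _, Or.inl rfl⟩, ?_⟩
          have := edge_self hj (f (t + 1) * (A g j)⁻¹)
          rw [inv_mul_cancel_right, ← h, iff_comm] at this
          exact this
      obtain ⟨S, ⟨i, hS⟩, h⟩ := this
      by_cases h1 : f t ∈ S
      · exact ⟨S, ⟨i, hS⟩, h1, by tauto⟩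
      · exact ⟨Sᶜ, ⟨i, hS.compl⟩, h1, by simp; tauto⟩
    choose! T hT1 hT2 hT3 using key
    have hcr : ∀ t < n, ¬ (f t ∈ T t ↔ f (t + 1) ∈ T t) := by
      intro t ht; simp [hT2 t ht, hT3 t ht]
    have hmaps : ∀ t < n, T t ∈ sep (f 0) (f n) := by
      intro t ht
      obtain ⟨i, hi⟩ := hT1 t ht
      refine ⟨⟨i, hi⟩, ?_, ?_⟩
      · by_contra hc
        obtain ⟨a, _, ha, ha'⟩ := ivt (Q := fun s => f s ∈ T t) (Nat.zero_le t)
          (by simp [hT2 t ht, hc])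
        exact once hf hi ha ht ha' (hcr t ht)
      · intro hc
        obtain ⟨a, ha, hb, ha'⟩ := ivt (Q := fun s => f s ∈ T t) (show t + 1 ≤ n from ht)
          (by simp [hT3 t ht, hc])
        exact once hf hi ha hb (hcr t ht) ha'
    have hinj : Set.InjOn T (Finset.range n : Set ℕ) := by
      intro s hs t ht hst
      simp only [Finset.coe_range, Set.mem_Iio] at hs ht
      by_contra hne
      rcases lt_or_gt_of_ne hne with h | h
      · obtain ⟨i, hi⟩ := hT1 s hs
        exact once hf hi h ht (hcr s hs) (by rw [hst]; exact hcr t ht)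
      · obtain ⟨i, hi⟩ := hT1 s hs
        exact once hf hi h hs (by rw [hst]; exact hcr t ht) (hcr s hs)
    have : (T '' (Finset.range n : Set ℕ)).ncard = n := by
      rw [Set.InjOn.ncard_image hinj, Set.ncard_coe_finset, Finset.card_range]
    rw [← this]
    conv_rhs => rw [this]
    apply Set.ncard_le_ncard _ (sep_finite _ _)
    rintro _ ⟨t, ht, rfl⟩
    exact hmaps t (by simpa using ht)

end hs
end SGP

namespace SGP
open SG Pointwise

section cross
variable {g : ℕ}

/-- crossing half-spaces -/
def Cross (S T : Set (SurfaceGroup g)) : Prop :=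
  (∃ p, p ∈ S ∧ p ∈ T) ∧ (∃ p, p ∈ S ∧ p ∉ T) ∧ (∃ p, p ∉ S ∧ p ∈ T) ∧ (∃ p, p ∉ S ∧ p ∉ T)

lemma Cross.symm {S T : Set (SurfaceGroup g)} (h : Cross S T) : Cross T S := by
  obtain ⟨⟨a, ha, ha'⟩, ⟨b, hb, hb'⟩, ⟨e, hc, hc'⟩, ⟨d, hd, hd'⟩⟩ := h
  exact ⟨⟨a, ha', ha⟩, ⟨e, hc', hc⟩, ⟨b, hb', hb⟩, ⟨d, hd', hd⟩⟩

lemma cross_compl_left {S T : Set (SurfaceGroup g)} : Cross Sᶜ T ↔ Cross S T := by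
  simp only [Cross, Set.mem_compl_iff, not_not]; tauto

lemma cross_compl_right {S T : Set (SurfaceGroup g)} : Cross S Tᶜ ↔ Cross S T := by
  simp only [Cross, Set.mem_compl_iff, not_not]; tauto

lemma Cross.smul {S T : Set (SurfaceGroup g)} (h : Cross S T) (u : SurfaceGroup g) :
    Cross (u • S) (u • T) := by
  obtain ⟨⟨a, ha, ha'⟩, ⟨b, hb, hb'⟩, ⟨e, hc, hc'⟩, ⟨d, hd, hd'⟩⟩ := h
  refine ⟨⟨u * a, ?_⟩, ⟨u * b, ?_⟩, ⟨u * e, ?_⟩, ⟨u * d, ?_⟩⟩ <;>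
    simp only [mem_smul, inv_mul_cancel_left] <;> tauto

lemma bdry_mem {i j : ℕ} {k : SurfaceGroup g} {T : Set (SurfaceGroup g)} (hi : i < 2 * g)
    (hT : HS j T) {p q : SurfaceGroup g} (hp : p ∈ H i k) (hq : q ∉ H i k) (hpT : p ∈ T)
    (hqT : q ∈ T) : ∃ a : ℤ, k * y g i ^ a * A g i ∈ T := by
  obtain ⟨f, hf, f0, fn⟩ := exists_geo p q
  generalize dd p q = n at *
  subst f0 fn
  obtain ⟨t, _, ht, h⟩ := ivt (Q := fun s => f s ∈ H i k) (Nat.zero_le n) (by simp [hp, hq])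
  obtain ⟨a, ha⟩ := cross_edge hi (hf.2 t ht) h
  refine ⟨a, ?_⟩
  rcases ha with ha | ha
  · rw [← ha.1]; exact conv hf hT hpT hqT ht.le
  · rw [← ha.1]; exact conv hf hT hpT hqT ht

lemma cross_bdry {i j : ℕ} {k : SurfaceGroup g} {T : Set (SurfaceGroup g)} (hi : i < 2 * g)
    (hT : HS j T) (h : Cross (H i k) T) :
    ∃ a b : ℤ, k * y g i ^ a * A g i ∈ T ∧ k * y g i ^ b * A g i ∉ T := by
  obtain ⟨⟨a, ha, ha'⟩, ⟨b, hb, hb'⟩, ⟨e, hc, hc'⟩, ⟨d, hd, hd'⟩⟩ := h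
  obtain ⟨s, hs⟩ := bdry_mem hi hT ha hc ha' hc'
  obtain ⟨t, ht⟩ := bdry_mem hi hT.compl hb hd hb' hd'
  exact ⟨s, t, hs, ht⟩

lemma cross_common_H {i j : ℕ} {k l : SurfaceGroup g} (hi : i < 2 * g) (hj : j < 2 * g)
    (h : Cross (H i k) (H j l)) : i ≠ j ∧ ∃ t : ℤ, H j l = H j (k * y g i ^ t) := by
  classical
  obtain ⟨a, b, ha, hb⟩ := cross_bdry hi (⟨hj, l, Or.inl rfl⟩ : HS j (H j l)) h
  have : ∃ t : ℤ, eta j (l⁻¹ * (k * y g i ^ t * A g i)) ≠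
      eta j (l⁻¹ * (k * y g i ^ (t + 1) * A g i)) := by
    by_contra hc
    push Not at hc
    have hconst : ∀ n : ℤ, eta j (l⁻¹ * (k * y g i ^ n * A g i)) =
        eta j (l⁻¹ * (k * y g i ^ (0 : ℤ) * A g i)) := by
      intro n
      induction n using Int.induction_on with
      | zero => rfl
      | succ n ih => rw [← hc, ih]
      | pred n ih => rw [hc (-(n : ℤ) - 1), sub_add_cancel, ih]
    apply hb
    change eta j _ = 1
    change eta j _ = 1 at ha
    rw [hconst b, ← hconst a, ha]
  obtain ⟨t, ht⟩ := this
  have e1 : l⁻¹ * (k * y g i ^ t * A g i) = (l⁻¹ * (k * y g i ^ t)) * A g i := by group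
  have e2 : l⁻¹ * (k * y g i ^ (t + 1) * A g i) = (l⁻¹ * (k * y g i ^ t)) * y g i * A g i := by
    rw [zpow_add_one]; group
  rw [e1, e2, eta_A j hj _ i hi.le, eta_A j hj _ i hi.le, eta_y j i hj hi, add_assoc,
    CharTwo.add_self_eq_zero, add_zero] at ht
  have hne : i ≠ j := by
    rintro rfl; simp at ht
  refine ⟨hne, t, ?_⟩
  by_cases hs : St g j (l⁻¹ * (k * y g i ^ t))
  · exact H_congr hj hs
  · simp [hs] at ht

lemma HS.not_cross {i : ℕ} {S T : Set (SurfaceGroup g)} (hS : HS i S) (hT : HS i T) :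
    ¬ Cross S T := by
  intro h
  obtain ⟨hi, k, rfl | rfl⟩ := hS <;> obtain ⟨_, l, rfl | rfl⟩ := hT <;>
    (try simp only [cross_compl_left, cross_compl_right] at h) <;>
    exact (cross_common_H hi hi h).1 rfl

open Classical in
/-- mod 2 indicator -/
noncomputable def ind (P : Prop) : ZMod 2 := if P then 1 else 0

lemma ind_pos {P : Prop} (h : P) : ind P = 1 := if_pos h
lemma ind_neg {P : Prop} (h : ¬ P) : ind P = 0 := if_neg h

lemma eta_pow (l i : ℕ) (hl : l < 2 * g) (hi : i < 2 * g) (hne : i ≠ l) :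
    ∃ e : ℕ, e ≤ 1 ∧ ∀ (p : SurfaceGroup g) (n : ℕ), eta l (p * y g i ^ n) = eta l p +
      ∑ t ∈ Finset.range n, ind (St g l (p * y g i ^ (t + e))) := by
  classical
  rcases lt_or_gt_of_ne hne with h | h
  · refine ⟨0, by omega, fun p n => ?_⟩
    induction n with
    | zero => simp
    | succ n ih =>
      rw [pow_succ, ← mul_assoc, eta_y l i hl hi, ih, Finset.sum_range_succ,
        if_neg (fun hh : l < i ∧ _ => absurd hh.1 (by omega)), add_zero, add_assoc]
      congr 2
      rw [add_zero]
      by_cases hs : St g l (p * y g i ^ n)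
      · rw [if_pos ⟨h, hs⟩, ind_pos hs]
      · rw [if_neg (fun hh => hs hh.2), ind_neg hs]
  · refine ⟨1, by omega, fun p n => ?_⟩
    induction n with
    | zero => simp
    | succ n ih =>
      rw [pow_succ, ← mul_assoc, eta_y l i hl hi, ih, Finset.sum_range_succ,
        if_neg (fun hh : i < l ∧ _ => absurd hh.1 (by omega)), add_zero, add_assoc]
      congr 2
      rw [mul_assoc, ← pow_succ]
      by_cases hs : St g l (p * y g i ^ (n + 1))
      · rw [if_pos ⟨h, hs⟩, ind_pos hs]
      · rw [if_neg (fun hh => hs hh.2), ind_neg hs]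

lemma nc {i j l r : ℕ} (hi : i < 2 * g) (hj : j < 2 * g) (hl : l < 2 * g) (hr : r < 2 * g)
    (hij : i ≠ j) (hil : i ≠ l) (hjl : j ≠ l) (hri : r ≠ i) (hrj : r ≠ j) (hrl : r ≠ l)
    {a b e : ℤ} (h : St g l (y g i ^ a * y g j ^ b * y g i ^ e)) : b = 0 ∧ a + e = 0 := by
  obtain ⟨d, hd⟩ := h
  have h1 := congrArg (al l) hd
  have h2 := congrArg (al i) hd
  have h3 := congrArg (al j) hd
  have h4 := congrArg (al r) hd
  simp only [al_mul, al_zpow, al_y _ _ hi hj, al_y _ _ hj hi, al_y _ _ hi hl, al_y _ _ hl hi,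
    al_y _ _ hj hl, al_y _ _ hl hj, al_y _ _ hr hi, al_y _ _ hr hj, al_y _ _ hr hl,
    al_y _ _ hi hi, al_y _ _ hj hj, al_y _ _ hl hl] at h1 h2 h3 h4
  rcases lt_or_gt_of_ne hij with o1 | o1 <;> rcases lt_or_gt_of_ne hil with o2 | o2 <;>
  rcases lt_or_gt_of_ne hjl with o3 | o3 <;> rcases lt_or_gt_of_ne hri with o4 | o4 <;>
  rcases lt_or_gt_of_ne hrj with o5 | o5 <;> rcases lt_or_gt_of_ne hrl with o6 | o6 <;>
  simp only [o1, o2, o3, o4, o5, o6, not_lt_of_gt, lt_irrefl, if_true, if_false] at h1 h2 h3 h4 <;>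
  omega

lemma no_commute (hg : 2 ≤ g) {i j : ℕ} (hi : i < 2 * g) (hj : j < 2 * g) (hij : i ≠ j) {n m : ℕ}
    (hn : n ≠ 0) (hm : m ≠ 0) (h : y g i ^ n * y g j ^ m = y g j ^ m * y g i ^ n) : False := by
  classical
  obtain ⟨l, hl, hil, hjl⟩ : ∃ l < 2 * g, i ≠ l ∧ j ≠ l := by
    by_contra hc; push Not at hc
    have := hc 0; have := hc 1; have := hc 2; omega
  obtain ⟨r, hr, hri, hrj, hrl⟩ : ∃ r < 2 * g, r ≠ i ∧ r ≠ j ∧ r ≠ l := by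
    by_contra hc; push Not at hc
    have := hc 0; have := hc 1; have := hc 2; have := hc 3; omega
  obtain ⟨e, he, hE⟩ := eta_pow l i hl hi hil
  obtain ⟨f, hf, hF⟩ := eta_pow l j hl hj hjl
  -- the stabiliser condition
  have key : ∀ (a b d : ℤ), St g l (y g i ^ a * y g j ^ b * y g i ^ d) ↔ b = 0 ∧ a + d = 0 := by
    intro a b d
    constructor
    · exact nc hi hj hl hr hij hil hjl hri hrj hrl
    · rintro ⟨rfl, h⟩
      refine ⟨0, ?_⟩
      rw [show d = -a by omega]; group
  have main : ∀ a : ℤ,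
      (∑ t ∈ Finset.range n, ind (a + (t + e : ℕ) = 0)) +
      (∑ s ∈ Finset.range m, ind (((s + f : ℕ) : ℤ) = 0 ∧ a + n = 0)) =
      (∑ s ∈ Finset.range m, ind (((s + f : ℕ) : ℤ) = 0 ∧ a = 0)) := by
    intro a
    have h1 : eta l (y g i ^ a * y g i ^ n * y g j ^ m) =
      eta l (y g i ^ a * y g j ^ m * y g i ^ n) := by
      rw [mul_assoc, h, mul_assoc]
    rw [hF, hE, hE, hF, add_assoc, add_assoc] at h1
    have h1 := add_left_cancel h1
    have e1 : ∀ t : ℕ, St g l (y g i ^ a * y g i ^ (t + e)) ↔ a + (t + e : ℕ) = 0 := by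
      intro t
      have := key a 0 (t + e : ℕ)
      rw [zpow_natCast] at this
      simpa using this
    have e2 : ∀ s : ℕ, St g l (y g i ^ a * y g i ^ n * y g j ^ (s + f)) ↔
        ((s + f : ℕ) : ℤ) = 0 ∧ a + n = 0 := by
      intro s
      have := key (a + n) (s + f : ℕ) 0
      rw [zpow_natCast, zpow_add, zpow_natCast, zpow_zero, mul_one, add_zero] at this
      exact this
    have e3 : ∀ s : ℕ, St g l (y g i ^ a * y g j ^ (s + f)) ↔
        ((s + f : ℕ) : ℤ) = 0 ∧ a = 0 := by
      intro s
      have := key a (s + f : ℕ) 0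
      rw [zpow_natCast, zpow_zero, mul_one, add_zero] at this
      exact this
    have e4 : ∀ t : ℕ, ¬ St g l (y g i ^ a * y g j ^ m * y g i ^ (t + e)) := by
      intro t ht
      have := key a (m : ℕ) (t + e : ℕ)
      rw [zpow_natCast, zpow_natCast] at this
      have := (this.1 ht).1
      omega
    simp only [e1, e2, e3, e4, ind_neg not_false, Finset.sum_const_zero, add_zero] at h1
    exact h1
  have z : ∀ (k : ℕ) (Q : ℕ → Prop), (∀ t < k, ¬ Q t) →
      (∑ t ∈ Finset.range k, ind (Q t)) = 0 := by
    intro k Q hQ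
    apply Finset.sum_eq_zero
    intro t ht
    rw [ind_neg (hQ t (Finset.mem_range.1 ht))]
  have o : ∀ (k : ℕ) (Q : ℕ → Prop) (t0 : ℕ), t0 < k → (∀ t < k, (Q t ↔ t = t0)) →
      (∑ t ∈ Finset.range k, ind (Q t)) = 1 := by
    intro k Q t0 ht0 hQ
    rw [Finset.sum_eq_single t0]
    · rw [ind_pos ((hQ t0 ht0).2 rfl)]
    · intro b hb hne
      rw [ind_neg (fun hq => hne ((hQ b (Finset.mem_range.1 hb)).1 hq))]
    · intro h; exact absurd (Finset.mem_range.2 ht0) h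
  have n01 : (0 : ZMod 2) ≠ 1 := by decide
  have fin : ∀ (a : ℤ) (X Y Z : ZMod 2), (∑ t ∈ Finset.range n, ind (a + (t + e : ℕ) = 0)) = X →
      (∑ s ∈ Finset.range m, ind (((s + f : ℕ) : ℤ) = 0 ∧ a + n = 0)) = Y →
      (∑ s ∈ Finset.range m, ind (((s + f : ℕ) : ℤ) = 0 ∧ a = 0)) = Z → X + Y = Z := by
    intro a X Y Z h1 h2 h3
    rw [← h1, ← h2, ← h3]; exact main a
  interval_cases e <;> interval_cases f
  · have := fin (-n) 0 1 0 (z _ _ (by intro t ht; omega))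
      (o _ _ 0 (by omega) (by intro t ht; omega)) (z _ _ (by intro t ht; omega))
    exact n01 (by simpa using this.symm)
  · have := fin 0 1 0 0 (o _ _ 0 (by omega) (by intro t ht; omega))
      (z _ _ (by intro t ht; omega)) (z _ _ (by intro t ht; omega))
    exact n01 (by simpa using this.symm)
  · have := fin 0 0 0 1 (z _ _ (by intro t ht; omega)) (z _ _ (by intro t ht; omega))
      (o _ _ 0 (by omega) (by intro t ht; omega))
    exact n01 (by simpa using this)
  · have := fin (-n) 1 0 0 (o _ _ (n - 1) (by omega) (by intro t ht; omega))
      (z _ _ (by intro t ht; omega)) (z _ _ (by intro t ht; omega))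
    exact n01 (by simpa using this.symm)

lemma no_commute_z (hg : 2 ≤ g) {i j : ℕ} (hi : i < 2 * g) (hj : j < 2 * g) (hij : i ≠ j) {n m : ℤ}
    (hn : n ≠ 0) (hm : m ≠ 0) (h : Commute (y g i ^ n) (y g j ^ m)) : False := by
  have h1 : Commute (y g i ^ n.natAbs) (y g j ^ m) := by
    rcases Int.natAbs_eq n with e | e
    · rw [e, zpow_natCast] at h; exact h
    · rw [e, zpow_neg, zpow_natCast] at h; exact Commute.inv_left_iff.1 h
  have h2 : Commute (y g i ^ n.natAbs) (y g j ^ m.natAbs) := by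
    rcases Int.natAbs_eq m with e | e
    · rw [e, zpow_natCast] at h1; exact h1
    · rw [e, zpow_neg, zpow_natCast] at h1; exact Commute.inv_right_iff.1 h1
  exact no_commute hg hi hj hij (by omega) (by omega) h2.eq

lemma quad_H (hg : 2 ≤ g) {i j : ℕ} (hi : i < 2 * g) (hj : j < 2 * g) {k k' l l' : SurfaceGroup g}
    (h1 : Cross (H i k) (H j l)) (h2 : Cross (H i k) (H j l')) (h3 : Cross (H i k') (H j l))
    (h4 : Cross (H i k') (H j l')) (hk : H i k ≠ H i k') (hl : H j l ≠ H j l') : False := by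
  obtain ⟨hij, t, ht⟩ := cross_common_H hi hj h1
  have hk' : H i k = H i (k * y g i ^ t) := H_congr hi ⟨t, by group⟩
  generalize k * y g i ^ t = h at *
  rw [hk', ht] at h1
  rw [hk'] at h2 hk
  rw [ht] at h3 hl
  obtain ⟨_, n, hn⟩ := cross_common_H hi hj h2
  obtain ⟨_, m, hm⟩ := cross_common_H hj hi h3.symm
  rw [hn, hm] at h4
  rw [hn] at hl
  rw [hm] at hk
  have hn0 : n ≠ 0 := by rintro rfl; simp at hl
  have hm0 : m ≠ 0 := by rintro rfl; simp at hk
  obtain ⟨_, a, ha⟩ := cross_common_H hi hj h4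
  obtain ⟨_, ⟨b, hb⟩, _⟩ := HS_cases hj hj (Or.inl ha)
  have hb' : y g i ^ (-n) * y g j ^ m * y g i ^ a = y g j ^ b := by
    rw [← hb]; group
  have a1 := congrArg (al i) hb'
  have a2 := congrArg (al j) hb'
  simp only [al_mul, al_zpow, al_y _ _ hi hj, al_y _ _ hj hi, al_y _ _ hi hi, al_y _ _ hj hj]
    at a1 a2
  have : b = m ∧ a = n := by
    rcases lt_or_gt_of_ne hij with o1 | o1 <;>
    simp only [o1, not_lt_of_gt, lt_irrefl, if_true, if_false] at a1 a2 <;> omega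
  obtain ⟨rfl, rfl⟩ := this
  apply no_commute_z hg hi hj hij hn0 hm0
  rw [Commute, SemiconjBy]
  conv_lhs => rw [← hb']
  group

lemma quad (hg : 2 ≤ g) {i j : ℕ} {S S' T T' : Set (SurfaceGroup g)}
    (hS : HS i S) (hS' : HS i S') (hT : HS j T) (hT' : HS j T')
    (h1 : Cross S T) (h2 : Cross S T') (h3 : Cross S' T) (h4 : Cross S' T')
    (n1 : S ≠ S') (n2 : S ≠ S'ᶜ) (n3 : T ≠ T') (n4 : T ≠ T'ᶜ) : False := by
  have hi := hS.lt
  have hj := hT.lt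
  obtain ⟨_, k, rfl | rfl⟩ := hS <;> obtain ⟨_, k', rfl | rfl⟩ := hS' <;>
  obtain ⟨_, l, rfl | rfl⟩ := hT <;> obtain ⟨_, l', rfl | rfl⟩ := hT' <;>
  (try simp only [cross_compl_left, cross_compl_right] at h1 h2 h3 h4) <;>
  refine quad_H hg hi hj h1 h2 h3 h4 ?_ ?_ <;> simp_all

/-! fixed half-spaces -/

lemma fixed_al {u : SurfaceGroup g} (hu : u ≠ 1) {i : ℕ} {S : Set (SurfaceGroup g)} (hS : HS i S)
    (h : u • S = S) : al i u = 0 ∧ ∀ j < 2 * g, j ≠ i → al j u ≠ 0 := by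
  obtain ⟨_, k, m, rfl⟩ := hS.smul_cases (Or.inl h)
  have hm : m ≠ 0 := by rintro rfl; simp at hu
  have e : ∀ j, al j (k * y g i ^ m * k⁻¹) = m * al j (y g i) := by
    intro j; simp only [al_mul, al_inv, al_zpow]; ring
  refine ⟨by rw [e, al_y _ _ hS.lt hS.lt]; simp, ?_⟩
  intro j hj hji
  rw [e, al_y _ _ hj hS.lt]
  rcases lt_or_gt_of_ne hji with o | o <;>
    simp only [o, not_lt_of_gt, if_true, if_false] <;> omega

lemma al_le_len {j : ℕ} (hj : j < 2 * g) (x : SurfaceGroup g) : |al j x| ≤ len g x :=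
  (Finset.single_le_sum (f := fun j => |al j x|) (fun _ _ => abs_nonneg _)
    (Finset.mem_range.2 hj)).trans (sum_al_le x)

/-- a half-space separating four points from far translates -/
lemma far_sep {u : SurfaceGroup g} {j : ℕ} (hj : j < 2 * g) (hu : al j u ≠ 0)
    (r : Fin 4 → SurfaceGroup g) :
    ∃ (M : ℕ) (T : Set (SurfaceGroup g)), (∃ i, HS i T) ∧
      ∀ a, r a ∈ T ∧ u ^ M * r a ∉ T := by
  by_contra hc
  push Not at hc
  set D := ∑ a, 2 * dd (r 0) (r a) with hD
  set M := D + 1 with hM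
  have sub : sep (r 0) (u ^ M * r 0) ⊆
      ⋃ a, (sep (r 0) (r a) ∪ sep (u ^ M * r a) (u ^ M * r 0)) := by
    rintro T ⟨h1, h2, h3⟩
    obtain ⟨a, ha⟩ := hc M T h1
    rw [Set.mem_iUnion]
    refine ⟨a, ?_⟩
    by_cases h : r a ∈ T
    · exact Or.inr ⟨h1, ha h, h3⟩
    · exact Or.inl ⟨h1, h2, h⟩
  have fin : ∀ a, (sep (r 0) (r a) ∪ sep (u ^ M * r a) (u ^ M * r 0)).Finite :=
    fun a => (sep_finite _ _).union (sep_finite _ _)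
  have c1 := Set.ncard_le_ncard sub (Set.finite_iUnion fin)
  have c2 : (⋃ a, (sep (r 0) (r a) ∪ sep (u ^ M * r a) (u ^ M * r 0))).ncard ≤ D := by
    have := Set.ncard_iUnion_le_of_fintype
      (fun a => (sep (r 0) (r a) ∪ sep (u ^ M * r a) (u ^ M * r 0)))
    refine this.trans ?_
    rw [hD]
    apply Finset.sum_le_sum
    intro a _
    refine (Set.ncard_union_le _ _).trans ?_
    rw [sep_card, sep_card, dd_left, dd_comm (r a)]
    omega
  rw [sep_card] at c1
  have c3 : (M : ℤ) ≤ dd (r 0) (u ^ M * r 0) := by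
    refine le_trans ?_ (al_le_len hj _)
    have : al j ((r 0)⁻¹ * (u ^ M * r 0)) = M * al j u := by
      simp only [al_mul, al_inv, al_pow]; ring
    rw [this, abs_mul, Nat.abs_cast]
    have : 1 ≤ |al j u| := Int.one_le_abs hu
    nlinarith
  omega

lemma exists_out {i : ℕ} {S : Set (SurfaceGroup g)} (hS : HS i S) : (∃ p, p ∈ S) ∧ ∃ p, p ∉ S := by
  obtain ⟨hi, k, rfl | rfl⟩ := hS
  all_goals
    have := edge_self hi k
    (try simp only [Set.mem_compl_iff, not_not])
    by_cases h1 : k * A g i ∈ H i k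
    · have h2 : k * A g i * c g i ∉ H i k := by tauto
      first | exact ⟨⟨_, h1⟩, ⟨_, h2⟩⟩ | exact ⟨⟨_, h2⟩, ⟨_, h1⟩⟩
    · have h2 : k * A g i * c g i ∈ H i k := by tauto
      first | exact ⟨⟨_, h2⟩, ⟨_, h1⟩⟩ | exact ⟨⟨_, h1⟩, ⟨_, h2⟩⟩

lemma fixed_unique (hg : 2 ≤ g) {u : SurfaceGroup g} (hu : u ≠ 1) {p : SurfaceGroup g}
    {S S' : Set (SurfaceGroup g)} (hS : ∃ i, HS i S) (hS' : ∃ i, HS i S') (hf : u • S = S)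
    (hf' : u • S' = S') (hp : p ∈ S) (hp' : p ∈ S') : S = S' := by
  by_contra hne
  obtain ⟨i, hS⟩ := hS
  obtain ⟨i', hS'⟩ := hS'
  have hii : i' = i := by
    by_contra hc
    exact (fixed_al hu hS hf).2 i' hS'.lt hc (fixed_al hu hS' hf').1
  subst hii
  obtain ⟨j, hj, hji⟩ : ∃ j < 2 * g, j ≠ i' := by
    by_contra hc; push Not at hc
    have := hc 0; have := hc 1; omega
  obtain ⟨q, hq⟩ := (exists_out hS).2
  obtain ⟨q', hq'⟩ := (exists_out hS').2
  obtain ⟨M, T, ⟨t, hT⟩, h⟩ := far_sep hj ((fixed_al hu hS hf).2 j hj hji) ![p, q, p, q']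
  have h0 := h 0
  have h1 := h 1
  have h3 := h 3
  simp only [Matrix.cons_val] at h0 h1 h3
  have stab : ∀ (V : Set (SurfaceGroup g)), u • V = V → ∀ (n : ℕ) x, u ^ n * x ∈ V ↔ x ∈ V := by
    intro V hV n
    induction n with
    | zero => simp
    | succ n ih =>
      intro x
      rw [pow_succ', mul_assoc]
      conv_lhs => rw [← hV, mem_smul, inv_mul_cancel_left, ih]
  have C1 : Cross S T := ⟨⟨p, hp, h0.1⟩, ⟨u ^ M * p, (stab S hf M p).2 hp, h0.2⟩,
    ⟨q, hq, h1.1⟩, ⟨u ^ M * q, fun hh => hq ((stab S hf M q).1 hh), h1.2⟩⟩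
  have C2 : Cross S' T := ⟨⟨p, hp', h0.1⟩, ⟨u ^ M * p, (stab S' hf' M p).2 hp', h0.2⟩,
    ⟨q', hq', h3.1⟩, ⟨u ^ M * q', fun hh => hq' ((stab S' hf' M q').1 hh), h3.2⟩⟩
  have hti : t ≠ i' := by
    rintro rfl; exact hS.not_cross hT C1
  have hTn : u • T ≠ T := fun hh => (fixed_al hu hS hf).2 t hT.lt hti (fixed_al hu hT hh).1
  have D1 := C1.smul u
  have D2 := C2.smul u
  rw [hf] at D1
  rw [hf'] at D2
  refine quad hg hS hS' hT (hT.smul u) C1 D1 C2 D2 hne ?_ hTn.symm ?_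
  · rintro hh
    rw [hh] at hp
    exact hp hp'
  · intro hh
    apply hT.smul_ne_compl u
    rw [hh, compl_compl]
    exact hh ▸ rfl

end cross
end SGP

namespace SGP
open SG Pointwise

section final
variable {g : ℕ}

/-- forward half-spaces of type `i` -/
def FW (u : SurfaceGroup g) (i : ℕ) (S : Set (SurfaceGroup g)) : Prop :=
  HS i S ∧ u • S ⊆ S ∧ u • S ≠ S

/-- half-spaces disjoint from their translate -/
def Out (u : SurfaceGroup g) (S : Set (SurfaceGroup g)) : Prop :=
  (∃ i, HS i S) ∧ ∀ p ∈ S, p ∉ u • S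

lemma classify (u : SurfaceGroup g) {i : ℕ} {S : Set (SurfaceGroup g)} (hS : HS i S) :
    u • S = S ∨ FW u i S ∨ FW u i Sᶜ ∨ Out u S ∨ Out u Sᶜ := by
  by_cases hf : u • S = S
  · exact Or.inl hf
  right
  have h := hS.not_cross (hS.smul u)
  unfold Cross at h
  by_cases h1 : ∃ p, p ∈ S ∧ p ∈ u • S
  swap
  · push Not at h1
    exact Or.inr (Or.inr (Or.inl ⟨⟨i, hS⟩, h1⟩))
  by_cases h2 : ∃ p, p ∈ S ∧ p ∉ u • S
  swap
  · push Not at h2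
    refine Or.inr (Or.inl ⟨hS.compl, ?_, ?_⟩)
    · rw [smul_compl]; exact Set.compl_subset_compl.2 h2
    · rw [smul_compl]; exact fun hh => hf (compl_injective hh)
  by_cases h3 : ∃ p, p ∉ S ∧ p ∈ u • S
  swap
  · push Not at h3
    refine Or.inl ⟨hS, ?_, hf⟩
    intro p hp
    by_contra hc
    exact h3 p hc hp
  by_cases h4 : ∃ p, p ∉ S ∧ p ∉ u • S
  · exact absurd ⟨h1, h2, h3, h4⟩ h
  · push Not at h4
    refine Or.inr (Or.inr (Or.inr ⟨⟨i, hS.compl⟩, ?_⟩))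
    intro p hp
    rw [smul_compl]
    simpa using h4 p hp

lemma pow_smul_anti {u : SurfaceGroup g} {S : Set (SurfaceGroup g)} (h : S ⊆ u • S) {m n : ℕ}
    (hmn : m ≤ n) : u ^ m • S ⊆ u ^ n • S := by
  induction n, hmn using Nat.le_induction with
  | base => exact subset_rfl
  | succ n hmn ih =>
    refine ih.trans ?_
    rw [pow_succ, mul_smul]
    exact Set.smul_set_mono h

lemma escape {u : SurfaceGroup g} {i : ℕ} {S : Set (SurfaceGroup g)} (hS : HS i S)
    (h : S ⊆ u • S) (hne : u • S ≠ S) (p : SurfaceGroup g) :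
    ∃ K : ℕ, ∀ k ≥ K, p ∈ u ^ k • S := by
  by_contra hc
  push Not at hc
  have hall : ∀ k : ℕ, p ∉ u ^ k • S := by
    intro k hk
    obtain ⟨m, hm, hm'⟩ := hc k
    exact hm' (pow_smul_anti h hm hk)
  obtain ⟨r, hr⟩ := (exists_out hS).1
  have hmem : ∀ k : ℕ, u ^ k • S ∈ sep r p := by
    intro k
    refine ⟨⟨i, hS.smul _⟩, ?_, hall k⟩
    have := pow_smul_anti h (Nat.zero_le k)
    rw [pow_zero, one_smul] at this
    exact this hr
  have hinj : Function.Injective (fun k : ℕ => u ^ k • S) := by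
    intro a b hab
    simp only at hab
    by_contra hne'
    have : ∀ a b : ℕ, a < b → u ^ a • S = u ^ b • S → False := by
      intro a b hlt hab
      have h1 := pow_smul_anti h (show a + 1 ≤ b by omega)
      rw [← hab, pow_succ, mul_smul] at h1
      rw [Set.smul_set_subset_smul_set_iff] at h1
      exact hne (h1.antisymm h)
    rcases lt_or_gt_of_ne hne' with hlt | hlt
    · exact this a b hlt hab
    · exact this b a hlt hab.symm
  exact Set.infinite_of_injective_forall_mem hinj hmem (sep_finite r p)

lemma FW.eventually {u : SurfaceGroup g} {i : ℕ} {S : Set (SurfaceGroup g)} (h : FW u i S)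
    (p : SurfaceGroup g) : ∃ K : ℕ, ∀ k ≥ K, u ^ k * p ∈ S := by
  obtain ⟨hS, h1, h2⟩ := h
  have e : S ⊆ u⁻¹ • S := by
    rw [Set.subset_smul_set_iff, inv_inv]; exact h1
  have e2 : u⁻¹ • S ≠ S := by
    intro hh
    apply h2
    conv_lhs => rw [← hh]
    rw [smul_inv_smul]
  obtain ⟨K, hK⟩ := escape hS e e2 p
  refine ⟨K, fun k hk => ?_⟩
  have := hK k hk
  rw [mem_smul] at this
  simpa using this

lemma FW.eventually_not {u : SurfaceGroup g} {i : ℕ} {S : Set (SurfaceGroup g)} (h : FW u i S)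
    (p : SurfaceGroup g) : ∃ K : ℕ, ∀ k ≥ K, (u ^ k)⁻¹ * p ∉ S := by
  obtain ⟨hS, h1, h2⟩ := h
  have e : Sᶜ ⊆ u • Sᶜ := by
    rw [smul_compl]; exact Set.compl_subset_compl.2 h1
  have e2 : u • Sᶜ ≠ Sᶜ := by
    rw [smul_compl]; exact fun hh => h2 (compl_injective hh)
  obtain ⟨K, hK⟩ := escape hS.compl e e2 p
  refine ⟨K, fun k hk => ?_⟩
  have := hK k hk
  rw [mem_smul] at this
  exact this

lemma FW.inter {u : SurfaceGroup g} {i j : ℕ} {S T : Set (SurfaceGroup g)} (h : FW u i S)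
    (h' : FW u j T) : (∃ p, p ∈ S ∧ p ∈ T) ∧ ∃ p, p ∉ S ∧ p ∉ T := by
  obtain ⟨K, hK⟩ := h.eventually 1
  obtain ⟨K', hK'⟩ := h'.eventually 1
  obtain ⟨L, hL⟩ := h.eventually_not 1
  obtain ⟨L', hL'⟩ := h'.eventually_not 1
  exact ⟨⟨_, hK (max K K') (le_max_left _ _), hK' _ (le_max_right _ _)⟩,
    ⟨_, hL (max L L') (le_max_left _ _), hL' _ (le_max_right _ _)⟩⟩

lemma FW.cross {u : SurfaceGroup g} {i j : ℕ} {S T : Set (SurfaceGroup g)} (h : FW u i S)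
    (h' : FW u j T) {p q : SurfaceGroup g} (h1 : p ∈ S) (h2 : p ∉ T) (h3 : q ∉ S) (h4 : q ∈ T) :
    Cross S T :=
  ⟨(h.inter h').1, ⟨p, h1, h2⟩, ⟨q, h3, h4⟩, (h.inter h').2⟩

lemma FW.smul {u h : SurfaceGroup g} (hc : Commute h u) {i : ℕ} {S : Set (SurfaceGroup g)}
    (hS : FW u i S) : FW u i (h • S) := by
  have e : u • h • S = h • u • S := by rw [← mul_smul, ← mul_smul, hc.eq]
  refine ⟨hS.1.smul h, ?_, ?_⟩
  · rw [e]; exact Set.smul_set_mono hS.2.1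
  · rw [e]; intro hh; exact hS.2.2 (smul_left_cancel h hh)

lemma Out.smul {u h : SurfaceGroup g} (hc : Commute h u) {S : Set (SurfaceGroup g)}
    (hS : Out u S) : Out u (h • S) := by
  have e : u • h • S = h • u • S := by rw [← mul_smul, ← mul_smul, hc.eq]
  obtain ⟨⟨i, h1⟩, h2⟩ := hS
  refine ⟨⟨i, h1.smul h⟩, ?_⟩
  intro p hp
  rw [e, mem_smul]
  rw [mem_smul] at hp
  exact h2 _ hp

/-- forward half-spaces entered from `p` to `q` -/
def fset (u : SurfaceGroup g) (i : ℕ) (p q : SurfaceGroup g) : Set (Set (SurfaceGroup g)) :=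
  {S | FW u i S ∧ p ∉ S ∧ q ∈ S}

lemma fset_finite (u : SurfaceGroup g) (i : ℕ) (p q : SurfaceGroup g) : (fset u i p q).Finite :=
  (sep_finite q p).subset (fun _ h => ⟨⟨i, h.1.1⟩, h.2.2, h.2.1⟩)

/-- number of forward half-spaces entered -/
noncomputable def fa (u : SurfaceGroup g) (i : ℕ) (p q : SurfaceGroup g) : ℤ := (fset u i p q).ncard

/-- signed count -/
noncomputable def F (u : SurfaceGroup g) (i : ℕ) (p q : SurfaceGroup g) : ℤ :=
  fa u i p q - fa u i q p

lemma fa_nonneg (u : SurfaceGroup g) (i : ℕ) (p q : SurfaceGroup g) : 0 ≤ fa u i p q := by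
  unfold fa; positivity

lemma F_neg (u : SurfaceGroup g) (i : ℕ) (p q : SurfaceGroup g) : F u i q p = - F u i p q := by
  unfold F; ring

lemma fa_split (u : SurfaceGroup g) (i : ℕ) (p q r : SurfaceGroup g) :
    fa u i p q = ({S | FW u i S ∧ p ∉ S ∧ q ∈ S ∧ r ∈ S}.ncard : ℤ) +
      ({S | FW u i S ∧ p ∉ S ∧ q ∈ S ∧ r ∉ S}.ncard : ℤ) := by
  have := Set.ncard_inter_add_ncard_diff_eq_ncard (fset u i p q) {S | r ∈ S} (fset_finite u i p q)
  unfold fa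
  rw [← this]
  push_cast
  congr 3
  · ext S; simp [fset]; tauto
  · ext S; simp [fset]; tauto

lemma F_add (u : SurfaceGroup g) (i : ℕ) (p q r : SurfaceGroup g) :
    F u i p q + F u i q r = F u i p r := by
  unfold F
  rw [fa_split u i p q r, fa_split u i q p r, fa_split u i q r p, fa_split u i r q p,
    fa_split u i p r q, fa_split u i r p q]
  have sw : ∀ (P Q R : Set (SurfaceGroup g) → Prop),
      {S | FW u i S ∧ P S ∧ Q S ∧ R S}.ncard = {S | FW u i S ∧ R S ∧ Q S ∧ P S}.ncard := by
    intro P Q R; congr 1; ext S; simp; tauto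
  have sw2 : ∀ (P Q R : Set (SurfaceGroup g) → Prop),
      {S | FW u i S ∧ P S ∧ Q S ∧ R S}.ncard = {S | FW u i S ∧ P S ∧ R S ∧ Q S}.ncard := by
    intro P Q R; congr 1; ext S; simp; tauto
  -- classes: membership of p, q, r
  have a1 := sw2 (fun S => p ∉ S) (fun S => q ∈ S) (fun S => r ∈ S)
  have a2 := sw (fun S => p ∉ S) (fun S => q ∈ S) (fun S => r ∉ S)
  have a3 := sw2 (fun S => q ∉ S) (fun S => p ∈ S) (fun S => r ∈ S)
  have a4 := sw (fun S => q ∉ S) (fun S => p ∈ S) (fun S => r ∉ S)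
  have a5 := sw (fun S => q ∉ S) (fun S => r ∈ S) (fun S => p ∉ S)
  have a6 := sw2 (fun S => r ∉ S) (fun S => q ∈ S) (fun S => p ∈ S)
  omega

lemma fa_smul {u h : SurfaceGroup g} (hc : Commute h u) (i : ℕ) (p q : SurfaceGroup g) :
    fa u i (h * p) (h * q) = fa u i p q := by
  unfold fa
  have : fset u i (h * p) (h * q) = (fun S => h • S) '' fset u i p q := by
    ext S
    constructor
    · rintro ⟨h1, h2, h3⟩
      refine ⟨h⁻¹ • S, ⟨h1.smul hc.inv_left, ?_, ?_⟩, smul_inv_smul h S⟩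
      · rw [mem_smul, inv_inv]; exact h2
      · rw [mem_smul, inv_inv]; exact h3
    · rintro ⟨T, ⟨h1, h2, h3⟩, rfl⟩
      refine ⟨h1.smul hc, ?_, ?_⟩
      · rw [mem_smul, inv_mul_cancel_left]; exact h2
      · rw [mem_smul, inv_mul_cancel_left]; exact h3
  rw [this, Set.ncard_image_of_injective _ (MulAction.injective h)]

lemma F_smul {u h : SurfaceGroup g} (hc : Commute h u) (i : ℕ) (p q : SurfaceGroup g) :
    F u i (h * p) (h * q) = F u i p q := by
  unfold F; rw [fa_smul hc, fa_smul hc]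

lemma fa_back (u : SurfaceGroup g) (i : ℕ) (p : SurfaceGroup g) : fa u i (u * p) p = 0 := by
  have : fset u i (u * p) p = ∅ := by
    ext S
    simp only [Set.mem_empty_iff_false, iff_false]
    rintro ⟨h1, h2, h3⟩
    apply h2
    apply h1.2.1
    rw [mem_smul, inv_mul_cancel_left]; exact h3
  simp [fa, this]

/-- translation length -/
noncomputable def tau (u : SurfaceGroup g) (i : ℕ) : ℤ := F u i 1 (u * 1)

lemma tau_eq (u : SurfaceGroup g) (i : ℕ) (p : SurfaceGroup g) : F u i p (u * p) = tau u i := by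
  have h1 := F_add u i p 1 (u * p)
  have h2 := F_add u i 1 (u * 1) (u * p)
  have h3 := F_smul (Commute.refl u) i 1 p
  have h4 := F_neg u i 1 p
  unfold tau
  omega

lemma tau_fa (u : SurfaceGroup g) (i : ℕ) (p : SurfaceGroup g) : fa u i p (u * p) = tau u i := by
  rw [← tau_eq u i p, F, fa_back, sub_zero]

lemma tau_nonneg (u : SurfaceGroup g) (i : ℕ) : 0 ≤ tau u i := by
  rw [← tau_fa u i 1]; exact fa_nonneg _ _ _ _

lemma F_zpow (u : SurfaceGroup g) (i : ℕ) (p : SurfaceGroup g) (k : ℤ) :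
    F u i p (u ^ k * p) = k * tau u i := by
  have step : ∀ k : ℤ, F u i p (u ^ (k + 1) * p) = F u i p (u ^ k * p) + tau u i := by
    intro k
    rw [← F_add u i p (u ^ k * p), ← tau_eq u i (u ^ k * p)]
    congr 2
    rw [← mul_assoc, add_comm, zpow_add, zpow_one]
  induction k using Int.induction_on with
  | zero => simp [F]
  | succ n ih => rw [step, ih]; ring
  | pred n ih =>
    have := step (-(n : ℤ) - 1)
    rw [sub_add_cancel, ih] at this
    linarith

lemma F_zpow' (u : SurfaceGroup g) (i : ℕ) (p q : SurfaceGroup g) (k : ℤ) :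
    F u i p (u ^ k * q) = F u i p q + k * tau u i := by
  rw [← F_add u i p q, F_zpow]

lemma fa_abs (u : SurfaceGroup g) (i : ℕ) (p q : SurfaceGroup g) :
    fa u i p q + fa u i q p = |F u i p q| := by
  have : fa u i p q = 0 ∨ fa u i q p = 0 := by
    by_contra hc
    push Not at hc
    obtain ⟨h1, h2⟩ := hc
    unfold fa at h1 h2
    have n1 : (fset u i p q).Nonempty := by
      apply Set.nonempty_of_ncard_ne_zero; exact_mod_cast h1
    have n2 : (fset u i q p).Nonempty := by
      apply Set.nonempty_of_ncard_ne_zero; exact_mod_cast h2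
    obtain ⟨S, hS, s1, s2⟩ := n1
    obtain ⟨T, hT, t1, t2⟩ := n2
    exact hS.1.not_cross hT.1 (hS.cross hT s2 t1 s1 t2)
  have p1 := fa_nonneg u i p q
  have p2 := fa_nonneg u i q p
  unfold F
  rcases this with h | h <;> rw [h]
  · rw [zero_sub, abs_neg, abs_of_nonneg p2]; simp
  · rw [sub_zero, abs_of_nonneg p1]; simp

lemma tau_zero {u : SurfaceGroup g} {i : ℕ} (h : tau u i = 0) (p q : SurfaceGroup g) :
    F u i p q = 0 := by
  have noF : ∀ S, ¬ FW u i S := by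
    intro S hS
    obtain ⟨K, hK⟩ := hS.eventually 1
    obtain ⟨L, hL⟩ := hS.eventually_not 1
    obtain ⟨t, _, _, ht⟩ := ivt (Q := fun t : ℕ => u ^ t * ((u ^ L)⁻¹ * 1) ∈ S)
      (Nat.zero_le (L + K)) (by
        have h1 := hL L le_rfl
        have h2 := hK K le_rfl
        have e : u ^ (L + K) * ((u ^ L)⁻¹ * 1) = u ^ K * 1 := by
          rw [add_comm, pow_add]; group
        simp only [e, pow_zero, one_mul]
        tauto)
    have ht' : u ^ t * ((u ^ L)⁻¹ * 1) ∉ S ∧ u * (u ^ t * ((u ^ L)⁻¹ * 1)) ∈ S := by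
      rw [← mul_assoc u, ← pow_succ']
      by_cases h1 : u ^ t * ((u ^ L)⁻¹ * 1) ∈ S
      · exfalso
        apply ht
        simp only [h1, true_iff]
        apply hS.2.1
        rw [mem_smul, pow_succ']
        simpa [mul_assoc] using h1
      · exact ⟨h1, by tauto⟩
    have h0 := tau_fa u i (u ^ t * ((u ^ L)⁻¹ * 1))
    rw [h, fa] at h0
    have : (fset u i (u ^ t * ((u ^ L)⁻¹ * 1)) (u * (u ^ t * ((u ^ L)⁻¹ * 1)))).ncard = 0 := by
      exact_mod_cast h0
    rw [Set.ncard_eq_zero (fset_finite _ _ _ _)] at this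
    have hm : S ∈ fset u i (u ^ t * ((u ^ L)⁻¹ * 1)) (u * (u ^ t * ((u ^ L)⁻¹ * 1))) :=
      ⟨hS, ht'⟩
    rw [this] at hm
    exact hm
  have e : ∀ p q, fset u i p q = ∅ := by
    intro p q; ext S; simp only [Set.mem_empty_iff_false, iff_false]; exact fun hh => noF S hh.1
  simp [F, fa, e]

lemma pair_lemma (hg : 2 ≤ g) (u : SurfaceGroup g) {i j : ℕ} (p q : SurfaceGroup g)
    (h1 : 1 ≤ F u i p q) (h2 : F u j p q ≤ - tau u j - 2) : False := by
  have f1 : 1 ≤ fa u i p q := by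
    have := fa_nonneg u i q p; unfold F at h1; omega
  have f2 : tau u j + 2 ≤ fa u j q p := by
    have := fa_nonneg u j p q; unfold F at h2; omega
  obtain ⟨S, hS, s1, s2⟩ : (fset u i p q).Nonempty := by
    apply Set.nonempty_of_ncard_ne_zero; unfold fa at f1; omega
  have sub : fset u j q p \ fset u j (u⁻¹ * p) p ⊆ fset u j q p := Set.diff_subset
  have f3 : fa u j (u⁻¹ * p) p = tau u j := by
    rw [← tau_fa u j (u⁻¹ * p), mul_inv_cancel_left]
  have f4 : 1 < (fset u j q p \ fset u j (u⁻¹ * p) p).ncard := by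
    have := Set.le_ncard_diff (fset u j (u⁻¹ * p) p) (fset u j q p) (fset_finite _ _ _ _)
    unfold fa at f2 f3
    omega
  rw [Set.one_lt_ncard_iff ((fset_finite _ _ _ _).subset sub)] at f4
  obtain ⟨T, T', hT, hT', hne⟩ := f4
  have key : ∀ V, V ∈ fset u j q p \ fset u j (u⁻¹ * p) p →
      FW u j V ∧ p ∈ V ∧ Cross S V ∧ Cross (u⁻¹ • S) V := by
    rintro V ⟨⟨hV, v1, v2⟩, v3⟩
    have v4 : p ∈ u • V := by
      rw [mem_smul]
      by_contra hc
      exact v3 ⟨hV, hc, v2⟩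
    have v5 : q ∉ u • V := fun hh => v1 (hV.2.1 hh)
    have C1 := hS.cross hV s2 v1 s1 v2
    have C2 := (hS.cross (hV.smul (Commute.refl u)) s2 v5 s1 v4).smul u⁻¹
    rw [inv_smul_smul] at C2
    exact ⟨hV, v2, C1, C2⟩
  obtain ⟨k1, k2, k3, k4⟩ := key T hT
  obtain ⟨l1, l2, l3, l4⟩ := key T' hT'
  refine quad hg hS.1 (hS.1.smul u⁻¹) k1.1 l1.1 k3 l3 k4 l4 ?_ ?_ hne ?_
  · intro hh
    apply hS.2.2
    conv_lhs => rw [hh]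
    rw [smul_inv_smul]
  · intro hh
    apply hS.1.smul_ne_compl u⁻¹
    conv_rhs => rw [hh]
    rw [compl_compl]
  · rintro rfl
    exact k2 l2

lemma helly (n : ℕ) (s t : ℕ → ℤ) (h0 : ∀ i < n, 0 ≤ t i) (h1 : ∀ i < n, t i = 0 → s i = 0)
    (h2 : ∀ i < n, ∀ j < n, ∀ k : ℤ, 1 ≤ s i + k * t i → s j + k * t j ≤ - t j - 2 → False) :
    ∃ K : ℤ, ∀ i < n, |s i + K * t i| ≤ t i + 1 := by
  classical
  set I := (Finset.range n).filter (fun i => 0 < t i) with hI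
  by_cases hne : I.Nonempty
  · obtain ⟨a, ha, hmin⟩ := Finset.exists_min_image I (fun i => (t i + 1 - s i) / t i) hne
    simp only [hI, Finset.mem_filter, Finset.mem_range] at ha
    set K := (t a + 1 - s a) / t a with hK
    have hKa : 1 ≤ s a + K * t a := by
      have := Int.lt_ediv_add_one_mul_self (t a + 1 - s a) ha.2
      rw [← hK] at this
      nlinarith
    refine ⟨K, fun j hj => ?_⟩
    have hlow : - t j - 1 ≤ s j + K * t j := by
      by_contra hc
      exact h2 a ha.1 j hj K hKa (by omega)
    have hup : s j + K * t j ≤ t j + 1 := by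
      rcases (h0 j hj).eq_or_lt with hz | hpos
      · rw [← hz, h1 j hj hz.symm]; simp
      · have hKj : K ≤ (t j + 1 - s j) / t j := hmin j (by simp [hI, hj, hpos])
        have := Int.ediv_mul_le (t j + 1 - s j) hpos.ne'
        nlinarith
    rw [abs_le]
    constructor <;> omega
  · refine ⟨0, fun j hj => ?_⟩
    have hz : t j = 0 := by
      by_contra hc
      apply hne
      refine ⟨j, ?_⟩
      simp only [hI, Finset.mem_filter, Finset.mem_range]
      exact ⟨hj, lt_of_le_of_ne (h0 j hj) (Ne.symm hc)⟩
    rw [h1 j hj hz, hz]; simp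

/-- all forward half-spaces entered -/
def fall (u : SurfaceGroup g) (n : ℕ) (p q : SurfaceGroup g) : Set (Set (SurfaceGroup g)) :=
  {S | ∃ i < n, S ∈ fset u i p q}

lemma fall_finite (u : SurfaceGroup g) (n : ℕ) (p q : SurfaceGroup g) : (fall u n p q).Finite :=
  (sep_finite q p).subset (fun _ ⟨i, _, h⟩ => ⟨⟨i, h.1.1⟩, h.2.2, h.2.1⟩)

lemma fall_card (u : SurfaceGroup g) (n : ℕ) (p q : SurfaceGroup g) :
    ((fall u n p q).ncard : ℤ) = ∑ i ∈ Finset.range n, fa u i p q := by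
  induction n with
  | zero =>
    have : fall u 0 p q = ∅ := by ext S; simp [fall]
    simp [this]
  | succ n ih =>
    have e : fall u (n + 1) p q = fall u n p q ∪ fset u n p q := by
      ext S
      simp only [fall, Set.mem_union, Set.mem_ofPred_eq]
      constructor
      · rintro ⟨i, hi, h⟩
        rcases Nat.lt_succ_iff_lt_or_eq.1 hi with h' | rfl
        · exact Or.inl ⟨i, h', h⟩
        · exact Or.inr h
      · rintro (⟨i, hi, h⟩ | h)
        · exact ⟨i, by omega, h⟩
        · exact ⟨n, by omega, h⟩
    have d : Disjoint (fall u n p q) (fset u n p q) := by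
      rw [Set.disjoint_left]
      rintro S ⟨i, hi, h⟩ h'
      have := h.1.1.type_unique h'.1.1
      omega
    rw [e, Set.ncard_union_eq d (fall_finite _ _ _ _) (fset_finite _ _ _ _), Finset.sum_range_succ,
      ← ih]
    simp [fa]

/-- out half-spaces containing `p` -/
def oset (u p : SurfaceGroup g) : Set (Set (SurfaceGroup g)) := {S | Out u S ∧ p ∈ S}

lemma oset_sub (u p : SurfaceGroup g) : oset u p ⊆ sep p (u * p) := by
  rintro S ⟨h1, h2⟩
  refine ⟨h1.1, h2, fun h => h1.2 _ h ?_⟩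
  rw [mem_smul, inv_mul_cancel_left]; exact h2

lemma oset_finite (u p : SurfaceGroup g) : (oset u p).Finite :=
  (sep_finite _ _).subset (oset_sub u p)

lemma oset_smul {u h : SurfaceGroup g} (hc : Commute h u) (p : SurfaceGroup g) :
    (oset u (h * p)).ncard = (oset u p).ncard := by
  have : oset u (h * p) = (fun S => h • S) '' oset u p := by
    ext S
    constructor
    · rintro ⟨h1, h2⟩
      refine ⟨h⁻¹ • S, ⟨h1.smul hc.inv_left, ?_⟩, smul_inv_smul h S⟩
      rw [mem_smul, inv_inv]; exact h2
    · rintro ⟨T, ⟨h1, h2⟩, rfl⟩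
      refine ⟨h1.smul hc, ?_⟩
      rw [mem_smul, inv_mul_cancel_left]; exact h2
  rw [this, Set.ncard_image_of_injective _ (MulAction.injective h)]

lemma lower (u p : SurfaceGroup g) :
    (2 * (oset u p).ncard : ℤ) + ∑ i ∈ Finset.range (2 * g), tau u i ≤ dd p (u * p) := by
  set X1 := oset u p
  set X2 := (fun T => (u • T)ᶜ) '' oset u p with hX2
  set X3 := (fun T : Set (SurfaceGroup g) => Tᶜ) '' fall u (2 * g) p (u * p) with hX3
  have f1 : X1.Finite := oset_finite u p
  have f2 : X2.Finite := (oset_finite u p).image _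
  have f3 : X3.Finite := (fall_finite _ _ _ _).image _
  have c2 : X2.ncard = X1.ncard := by
    apply Set.ncard_image_of_injective
    intro S T hST
    exact smul_left_cancel u (compl_injective hST)
  have c3 : (X3.ncard : ℤ) = ∑ i ∈ Finset.range (2 * g), tau u i := by
    rw [hX3, Set.ncard_image_of_injective _ compl_injective, fall_card]
    exact Finset.sum_congr rfl (fun i _ => tau_fa u i p)
  have d12 : Disjoint X1 X2 := by
    rw [Set.disjoint_left]
    rintro S hS ⟨T, hT, rfl⟩
    obtain ⟨⟨i, hi⟩, h1⟩ := (hT.1.smul (Commute.refl u))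
    have h2 := hS.1.2
    simp only at h2
    apply hi.smul_ne_compl u
    ext x
    constructor
    · intro hx hx'
      exact h1 x hx' hx
    · intro hx
      have := h2 x hx
      rw [smul_compl] at this
      simpa using this
  have d3 : Disjoint (X1 ∪ X2) X3 := by
    rw [Set.disjoint_left]
    rintro S hS ⟨T, ⟨i, _, ⟨hT, _⟩⟩, rfl⟩
    rcases hS with hS | ⟨V, hV, hVT⟩
    · obtain ⟨x, hx⟩ := (exists_out hT.1).2
      apply hS.1.2 x hx
      rw [smul_compl]
      exact fun hh => hx (hT.2.1 hh)
    · simp only at hVT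
      have e : u • V = T := compl_injective hVT
      have h1 := (hV.1.smul (Commute.refl u)).2
      rw [e] at h1
      obtain ⟨x, hx⟩ := (exists_out (hT.1.smul u)).1
      exact h1 x (hT.2.1 hx) hx
  have sub : X1 ∪ X2 ∪ X3 ⊆ sep p (u * p) := by
    rintro S ((hS | ⟨T, hT, rfl⟩) | ⟨T, ⟨i, _, hT⟩, rfl⟩)
    · exact oset_sub u p hS
    · obtain ⟨⟨i, hi⟩, h1⟩ := hT.1
      refine ⟨⟨i, (hi.smul u).compl⟩, h1 p hT.2, ?_⟩
      simp only [Set.mem_compl_iff, not_not]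
      rw [mem_smul, inv_mul_cancel_left]; exact hT.2
    · refine ⟨⟨i, hT.1.1.compl⟩, hT.2.1, ?_⟩
      simpa using hT.2.2
  have := Set.ncard_le_ncard sub (sep_finite _ _)
  rw [Set.ncard_union_eq d3 (f1.union f2) f3, Set.ncard_union_eq d12 f1 f2, sep_card, c2] at this
  rw [← c3]
  omega

lemma upper (hg : 2 ≤ g) {u : SurfaceGroup g} (hu : u ≠ 1) (p q : SurfaceGroup g) :
    (dd p q : ℤ) ≤ (oset u p).ncard + (oset u q).ncard + 1 +
      ∑ i ∈ Finset.range (2 * g), |F u i p q| := by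
  set X0 := {S | S ∈ sep p q ∧ u • S = S} with hX0
  set X2 := (fun T : Set (SurfaceGroup g) => Tᶜ) '' oset u q
  set X3 := (fun T : Set (SurfaceGroup g) => Tᶜ) '' fall u (2 * g) p q
  have sub : sep p q ⊆ X0 ∪ (oset u p ∪ X2) ∪ (fall u (2 * g) q p ∪ X3) := by
    rintro S ⟨⟨i, hS⟩, h1, h2⟩
    rcases classify u hS with h | h | h | h | h
    · exact Or.inl (Or.inl ⟨⟨⟨i, hS⟩, h1, h2⟩, h⟩)
    · exact Or.inr (Or.inl ⟨i, hS.lt, h, h2, h1⟩)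
    · exact Or.inr (Or.inr ⟨Sᶜ, ⟨i, hS.lt, h, by simpa using h1, h2⟩, compl_compl S⟩)
    · exact Or.inl (Or.inr (Or.inl ⟨h, h1⟩))
    · exact Or.inl (Or.inr (Or.inr ⟨Sᶜ, ⟨h, h2⟩, compl_compl S⟩))
  have f0 : X0.Finite := (sep_finite p q).subset (fun _ h => h.1)
  have f2 : X2.Finite := (oset_finite u q).image _
  have f3 : X3.Finite := (fall_finite _ _ _ _).image _
  have c0 : X0.ncard ≤ 1 := by
    rw [Set.ncard_le_one f0]
    rintro S ⟨⟨h1, h2, _⟩, h3⟩ T ⟨⟨k1, k2, _⟩, k3⟩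
    exact fixed_unique hg hu h1 k1 h3 k3 h2 k2
  have c2 : X2.ncard = (oset u q).ncard := Set.ncard_image_of_injective _ compl_injective
  have c3 : X3.ncard = (fall u (2 * g) p q).ncard := Set.ncard_image_of_injective _ compl_injective
  have := Set.ncard_le_ncard sub
    ((f0.union ((oset_finite u p).union f2)).union ((fall_finite _ _ _ _).union f3))
  rw [sep_card] at this
  have u1 := Set.ncard_union_le (X0 ∪ (oset u p ∪ X2)) (fall u (2 * g) q p ∪ X3)
  have u2 := Set.ncard_union_le X0 (oset u p ∪ X2)
  have u3 := Set.ncard_union_le (oset u p) X2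
  have u4 := Set.ncard_union_le (fall u (2 * g) q p) X3
  have e : ∑ i ∈ Finset.range (2 * g), |F u i p q| =
      ((fall u (2 * g) p q).ncard : ℤ) + (fall u (2 * g) q p).ncard := by
    rw [fall_card, fall_card, ← Finset.sum_add_distrib]
    exact Finset.sum_congr rfl (fun i _ => (fa_abs u i p q).symm)
  rw [e]
  omega

lemma main_bound (hg : 2 ≤ g) {u : SurfaceGroup g} (hu : u ≠ 1) (x : SurfaceGroup g) :
    ∃ K : ℤ, 2 * len g (u ^ K * x) ≤ len g u + len g (x⁻¹ * u * x) + 4 * g + 2 := by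
  obtain ⟨K, hK⟩ := helly (2 * g) (fun i => F u i 1 x) (fun i => tau u i)
    (fun i _ => tau_nonneg u i) (fun i _ h => tau_zero h _ _)
    (by
      intro i _ j _ k h1 h2
      rw [← F_zpow'] at h1 h2
      exact pair_lemma hg u _ _ h1 h2)
  refine ⟨K, ?_⟩
  have h1 := upper hg hu 1 (u ^ K * x)
  have hc : Commute (u ^ K) u := (Commute.refl u).zpow_left K
  rw [oset_smul hc] at h1
  have h2 : ∑ i ∈ Finset.range (2 * g), |F u i 1 (u ^ K * x)| ≤
      ∑ i ∈ Finset.range (2 * g), (tau u i + 1) := by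
    apply Finset.sum_le_sum
    intro i hi
    rw [F_zpow']
    exact hK i (Finset.mem_range.1 hi)
  rw [Finset.sum_add_distrib] at h2
  simp only [Finset.sum_const, Finset.card_range, nsmul_eq_mul, mul_one] at h2
  have h3 := lower u 1
  have h4 := lower u x
  have e1 : dd 1 (u * 1) = len g u := by simp [dd]
  have e2 : dd x (u * x) = len g (x⁻¹ * u * x) := by rw [dd, mul_assoc]
  have e3 : dd 1 (u ^ K * x) = len g (u ^ K * x) := by simp [dd]
  rw [e1] at h3
  rw [e2] at h4
  rw [e3] at h1
  push_cast at h2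
  omega

lemma parity (u x : SurfaceGroup g) : Even (len g u + len g (x⁻¹ * u * x)) := by
  obtain ⟨m, hm⟩ := len_parity u
  obtain ⟨n, hn⟩ := len_parity (x⁻¹ * u * x)
  have : ∀ j, al j (x⁻¹ * u * x) = al j u := by
    intro j; simp only [al_mul, al_inv]; ring
  simp only [this] at hn
  rw [Nat.even_iff]
  omega

end final
end SGP

theorem surface_group_conjugator_bound (g : ℕ) (hg : 2 ≤ g) (u v : SG.SurfaceGroup g)
    (h : ∃ x : SG.SurfaceGroup g, x⁻¹ * u * x = v) :
    Even (SG.len g u + SG.len g v) ∧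
    ∃ x : SG.SurfaceGroup g, x⁻¹ * u * x = v ∧
      SG.len g x ≤ (SG.len g u + SG.len g v)/2 + 8*g - 1 := by
  obtain ⟨x, rfl⟩ := h
  refine ⟨SGP.parity u x, ?_⟩
  by_cases hu : u = 1
  · subst hu
    refine ⟨1, by simp, ?_⟩
    rw [SGP.len_one]; omega
  · obtain ⟨K, hK⟩ := SGP.main_bound hg hu x
    refine ⟨u ^ K * x, ?_, by omega⟩
    have : (u ^ K * x)⁻¹ * u * (u ^ K * x) = x⁻¹ * ((u ^ K)⁻¹ * (u * u ^ K)) * x := by group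
    rw [this, ((Commute.refl u).zpow_right K).eq]
    group
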